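/- arXiv:2005.13878 — 6 statements merged into one kernel-verified Lean document; each statement's English description precedes it below -/
import Mathlib

section
/- For every real t > 0, i·(1 - t·β(t/2)) = ∫_ℝ (1 + itx)/(it - x) · (1/2)·|x| / ((1 + x²)·sinh(π|x|/2)) dx, where the integral is complex-valued and β(z) := ∫_0^∞ e^{-zs}/(1 + e^{-s}) ds for z > 0. -/
open MeasureTheory

/-- The beta function via its Laplace-integral representation,
`β(z) = ∫_0^∞ e^{-zs}/(1 + e^{-s}) ds` for `z > 0`. -/
noncomputable def betaFn (z : ℝ) : ℝ :=
  ∫ s in Set.Ioi (0 : ℝ), Real.exp (-z * s) / (1 + Real.exp (-s))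

open scoped Real

/-- The Laplace transform of `sin (u x)`. -/
theorem integral_exp_neg_mul_sin {a : ℝ} (ha : 0 < a) (u : ℝ) :
    ∫ x in Set.Ioi (0 : ℝ), Real.exp (-a * x) * Real.sin (u * x) = u / (a ^ 2 + u ^ 2) := by
  have hre : ((-a : ℂ) + u * Complex.I).re < 0 := by simpa using ha
  have h := integral_exp_mul_complex_Ioi hre 0
  have hi := integrableOn_exp_mul_complex_Ioi hre 0
  have h2 := integral_im hi
  rw [h] at h2
  have e : ∀ x : ℝ, RCLike.im (Complex.exp (((-a : ℂ) + u * Complex.I) * x)) =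
      Real.exp (-a * x) * Real.sin (u * x) := by
    intro x
    simp [Complex.exp_im]
  simp_rw [e] at h2
  rw [h2]
  simp [Complex.div_im, Complex.normSq_apply]
  ring_nf

theorem integrableOn_exp_neg_mul_sin {a : ℝ} (ha : 0 < a) (u : ℝ) :
    IntegrableOn (fun x => Real.exp (-a * x) * Real.sin (u * x)) (Set.Ioi 0) := by
  refine (integrableOn_exp_mul_Ioi (a := -a) (by linarith) 0).mono'
    (by fun_prop) (.of_forall fun x => ?_)
  rw [norm_mul, Real.norm_eq_abs, Real.abs_exp]
  exact mul_le_of_le_one_right (Real.exp_pos _).le (Real.abs_sin_le_one _)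

theorem integrableOn_mul_exp_neg {a : ℝ} (ha : 0 < a) :
    IntegrableOn (fun x => x * Real.exp (-a * x)) (Set.Ioi 0) := by
  have := integrableOn_rpow_mul_exp_neg_mul_rpow (s := 1) (p := 1) (b := a) (by norm_num) one_pos ha
  simpa using this

theorem integral_mul_exp_neg {a : ℝ} (ha : 0 < a) :
    ∫ x in Set.Ioi (0 : ℝ), x * Real.exp (-a * x) = 1 / a ^ 2 := by
  have := Real.integral_rpow_mul_exp_neg_mul_Ioi (a := 2) (r := a) (by norm_num) ha
  norm_num at this
  simpa [Real.Gamma_two] using this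

/-- The expansion of `1 / sinh` as a geometric series of exponentials. -/
theorem hasSum_inv_sinh {y : ℝ} (hy : 0 < y) :
    HasSum (fun k : ℕ => 2 * Real.exp (-((2 * k + 1) * y))) (1 / Real.sinh y) := by
  have hlt : Real.exp (-(2 * y)) < 1 := by simpa using hy
  have h := (hasSum_geometric_of_lt_one (Real.exp_pos _).le hlt).mul_left (2 * Real.exp (-y))
  convert! h using 1
  · funext k
    rw [← Real.exp_nat_mul, mul_assoc, ← Real.exp_add]
    ring_nf
  · have hs : 0 < Real.sinh y := Real.sinh_pos_iff.2 hy
    have h1 : (1 - Real.exp (-(2 * y))) ≠ 0 := by linarith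
    rw [← div_eq_mul_inv, div_eq_div_iff hs.ne' h1, Real.sinh_eq,
      show -(2 * y) = -y + -y by ring, Real.exp_add]
    have : Real.exp y * Real.exp (-y) = 1 := by rw [← Real.exp_add]; simp
    linear_combination -this

open Complex in
/-- The Mittag-Leffler expansion of `tanh`. -/
theorem hasSum_tanh {u : ℝ} (hu : 0 < u) :
    HasSum (fun k : ℕ => 2 * u / (((2 * k + 1) * π / 2) ^ 2 + u ^ 2)) (Real.tanh u) := by
  have hπ : (π : ℂ) ≠ 0 := by exact_mod_cast Real.pi_ne_zero
  have hu' : (u : ℂ) ≠ 0 := by exact_mod_cast hu.ne'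
  have hmem : ∀ {z : ℂ}, z.im ≠ 0 → z ∈ integerComplement := by
    rintro z hz ⟨n, rfl⟩
    simp at hz
  obtain ⟨z, hz⟩ : ∃ z : ℂ, z = I * u / π := ⟨_, rfl⟩
  have hzim : z.im = u / π := by
    have : z = ((u / π : ℝ) : ℂ) * I := by rw [hz]; push_cast; ring
    rw [this]; simp
  have hzpos : 0 < z.im := by rw [hzim]; positivity
  have h1 : z ∈ integerComplement := hmem hzpos.ne'
  have h2 : 2 * z ∈ integerComplement := hmem (by simp [hzpos.ne'])
  have hz0 : z ≠ 0 := integerComplement.ne_zero h1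
  have s2 := summable_cotTerm h2
  have c1 := cot_series_rep' h1
  have c2 := cot_series_rep' h2
  have hs2e : Summable fun k : ℕ => cotTerm (2 * z) (2 * k) :=
    s2.comp_injective (i := fun k : ℕ => 2 * k) (fun a b h => by simpa using h)
  have hs2o : Summable fun k : ℕ => cotTerm (2 * z) (2 * k + 1) :=
    s2.comp_injective (i := fun k : ℕ => 2 * k + 1) (fun a b h => by simpa using h)
  have hsplit := tsum_even_add_odd hs2e hs2o
  have hodd : ∀ k : ℕ, cotTerm (2 * z) (2 * k + 1) = 1 / 2 * cotTerm z k := by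
    intro k
    have hm : z - (k + 1) ≠ 0 := by
      simpa [sub_eq_add_neg, add_comm] using integerComplement_add_ne_zero h1 (-(k + 1 : ℤ))
    have hp : z + (k + 1) ≠ 0 := by
      simpa using integerComplement_add_ne_zero h1 (k + 1 : ℤ)
    have e1 : 2 * z - ((2 * k + 1 : ℕ) + 1) = 2 * (z - (k + 1)) := by push_cast; ring
    have e2 : 2 * z + ((2 * k + 1 : ℕ) + 1) = 2 * (z + (k + 1)) := by push_cast; ring
    rw [cotTerm, cotTerm, e1, e2]
    field_simp
  have hcosh : cosh (u : ℂ) ≠ 0 := by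
    rw [← ofReal_cosh]; exact_mod_cast (Real.cosh_pos u).ne'
  have hsinh : sinh (u : ℂ) ≠ 0 := by
    rw [← ofReal_sinh]; exact_mod_cast (Real.sinh_pos_iff.2 hu).ne'
  have hpz : π * z = u * I := by rw [hz]; field_simp
  have hE : ∑' k : ℕ, cotTerm (2 * z) (2 * k) = -(π / 2) * I * Real.tanh u := by
    have : ∑' k : ℕ, cotTerm (2 * z) (2 * k) =
        (π * cot (π * (2 * z)) - 1 / (2 * z)) - 1 / 2 * (π * cot (π * z) - 1 / z) := by
      rw [c1, c2, ← tsum_mul_left, eq_sub_iff_add_eq]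
      simp_rw [hodd] at hsplit
      exact hsplit
    rw [this, show (π : ℂ) * (2 * z) = 2 * (π * z) by ring, hpz, ofReal_tanh,
      Complex.tanh_eq_sinh_div_cosh, cot, cot, Complex.cos_two_mul, Complex.sin_two_mul, sin_mul_I, cos_mul_I]
    have := Complex.cosh_sq (u : ℂ)
    field_simp
    rw [I_sq]
    linear_combination (π * z : ℂ) * this
  have key := (hs2e.hasSum_iff.2 hE).mul_left (2 * I / π)
  rw [← Complex.hasSum_ofReal]
  convert! key using 1
  · funext k
    have hp := integerComplement_add_ne_zero h2 (2 * k + 1 : ℤ)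
    have hm := integerComplement_add_ne_zero h2 (-(2 * k + 1) : ℤ)
    push_cast at hp hm
    have hd : ((((2 * k + 1) * π / 2) ^ 2 + u ^ 2 : ℝ) : ℂ) ≠ 0 := by
      have : 0 < ((2 * k + 1) * π / 2) ^ 2 + u ^ 2 := by positivity
      exact_mod_cast this.ne'
    push_cast at hd
    have : cotTerm (2 * z) (2 * k) = 4 * z / ((2 * z + (2 * k + 1)) * (2 * z + -(2 * k + 1))) := by
      rw [cotTerm, sub_eq_add_neg]
      push_cast
      field_simp
      ring
    rw [this]
    have e : (2 * z + (2 * k + 1)) * (2 * z + -(2 * k + 1)) =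
        -(4 / π ^ 2) * (((2 * k + 1) * π / 2) ^ 2 + u ^ 2) := by
      rw [hz]; field_simp; ring_nf; rw [I_sq]; ring
    rw [e]
    push_cast
    rw [hz]
    field_simp
    ring_nf
    rw [I_sq]
    ring
  · field_simp
    rw [I_sq]
    ring

/-- The Fourier sine transform of `1 / sinh (π x / 2)` is `tanh`. -/
theorem integral_sin_div_sinh {u : ℝ} (hu : 0 < u) :
    ∫ x in Set.Ioi (0 : ℝ), Real.sin (u * x) / Real.sinh (π * x / 2) = Real.tanh u := by
  set a : ℕ → ℝ := fun k => (2 * k + 1) * π / 2 with ha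
  have ha1 : ∀ k : ℕ, (k : ℝ) + 1 ≤ a k := by
    intro k
    have := Real.pi_gt_three
    have hk : (0 : ℝ) ≤ k := k.cast_nonneg
    simp only [ha]
    nlinarith
  have hapos : ∀ k, 0 < a k := fun k => by simp only [ha]; positivity
  let F : ℕ → ℝ → ℝ := fun k x => 2 * (Real.exp (-a k * x) * Real.sin (u * x))
  have hint : ∀ k, IntegrableOn (F k) (Set.Ioi 0) := fun k =>
    (integrableOn_exp_neg_mul_sin (hapos k) u).const_mul 2
  have hnorm : ∀ k, ∫ x in Set.Ioi (0 : ℝ), ‖F k x‖ ≤ 2 * u * (1 / ((k : ℝ) + 1) ^ 2) := by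
    intro k
    have h1 : ∫ x in Set.Ioi (0 : ℝ), ‖F k x‖ ≤
        ∫ x in Set.Ioi (0 : ℝ), 2 * u * (x * Real.exp (-a k * x)) := by
      refine setIntegral_mono_on (hint k).norm
        ((integrableOn_mul_exp_neg (hapos k)).const_mul _) measurableSet_Ioi fun x hx => ?_
      have hx : 0 < x := hx
      have hs : |Real.sin (u * x)| ≤ u * x := by
        simpa [abs_of_pos (mul_pos hu hx)] using Real.abs_sin_le_abs (x := u * x)
      simp only [F, norm_mul, Real.norm_eq_abs, Real.abs_exp, Nat.abs_ofNat]
      have := mul_le_mul_of_nonneg_left hs (Real.exp_pos (-a k * x)).le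
      linarith
    rw [integral_const_mul, integral_mul_exp_neg (hapos k)] at h1
    refine h1.trans ?_
    gcongr
    exact ha1 k
  have hsum : Summable fun k => ∫ x in Set.Ioi (0 : ℝ), ‖F k x‖ := by
    refine Summable.of_nonneg_of_le (fun k => integral_nonneg fun x => norm_nonneg _) hnorm
      (Summable.mul_left _ ?_)
    simpa using (summable_nat_add_iff 1).2 (Real.summable_one_div_nat_pow.2 one_lt_two)
  have key := hasSum_integral_of_summable_integral_norm hint hsum
  have hF : ∀ k, ∫ x in Set.Ioi (0 : ℝ), F k x = 2 * u / (((2 * k + 1) * π / 2) ^ 2 + u ^ 2) := by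
    intro k
    rw [integral_const_mul, integral_exp_neg_mul_sin (hapos k)]
    ring
  simp_rw [hF] at key
  rw [← key.unique (hasSum_tanh hu)]
  refine setIntegral_congr_fun measurableSet_Ioi fun x hx => ?_
  have hx : 0 < x := hx
  have := (hasSum_inv_sinh (y := π * x / 2) (by positivity)).mul_right (Real.sin (u * x))
  have h2 := this.tsum_eq
  simp only [F]
  rw [div_eq_mul_one_div, mul_comm, ← h2]
  congr 1
  ext k
  simp only [ha]
  ring_nf

theorem mul_div_sinh_le {y : ℝ} (hy : 0 < y) : y / Real.sinh y ≤ 8 * (1 + y ^ 2)⁻¹ := by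
  have h1 : y / 2 ≤ Real.sinh (y / 2) := Real.self_le_sinh_iff.2 (by linarith)
  have h2 : 1 + (y / 2) ^ 2 / 2 ≤ Real.cosh (y / 2) := by
    have h4 : y / 4 ≤ Real.sinh (y / 4) := Real.self_le_sinh_iff.2 (by linarith)
    rw [show y / 2 = 2 * (y / 4) by ring, Real.cosh_two_mul, Real.cosh_sq]
    nlinarith
  have h3 : Real.sinh y = 2 * Real.sinh (y / 2) * Real.cosh (y / 2) := by
    rw [← Real.sinh_two_mul]; ring_nf
  have h4 : y * (1 + (y / 2) ^ 2 / 2) ≤ Real.sinh y := by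
    rw [h3]
    have := mul_le_mul (mul_le_mul_of_nonneg_left h1 zero_le_two) h2 (by positivity)
      (by linarith)
    linarith
  rw [← div_eq_mul_inv, div_le_div_iff₀ (Real.sinh_pos_iff.2 hy) (by positivity)]
  nlinarith [pow_pos hy 3]

theorem integrableOn_div_sinh :
    IntegrableOn (fun x => x / Real.sinh (π * x / 2)) (Set.Ioi 0) := by
  have h := ((integrable_inv_one_add_sq.comp_mul_left' (R := π / 2)
    (by positivity)).const_mul (8 * (2 / π))).integrableOn (s := Set.Ioi 0)
  refine h.mono' (by apply Measurable.aestronglyMeasurable; fun_prop) ((ae_restrict_mem measurableSet_Ioi).mono fun x hx => ?_)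
  have hx : 0 < x := hx
  have hy : 0 < π * x / 2 := by positivity
  have hs := Real.sinh_pos_iff.2 hy
  rw [Real.norm_of_nonneg (by positivity)]
  have := mul_le_mul_of_nonneg_left (mul_div_sinh_le hy) (show 0 ≤ 2 / π by positivity)
  calc x / Real.sinh (π * x / 2) = 2 / π * (π * x / 2 / Real.sinh (π * x / 2)) := by
        field_simp
    _ ≤ _ := this
    _ = _ := by ring_nf

theorem integral_div_sinh_eq {t : ℝ} (ht : 0 < t) :
    ∫ x in Set.Ioi (0 : ℝ), x / ((t ^ 2 + x ^ 2) * Real.sinh (π * x / 2)) =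
      ∫ u in Set.Ioi (0 : ℝ), Real.exp (-t * u) * Real.tanh u := by
  let G : ℝ → ℝ → ℝ := fun x u => Real.exp (-t * u) * Real.sin (x * u) / Real.sinh (π * x / 2)
  have hG : Integrable (Function.uncurry G)
      ((volume.restrict (Set.Ioi 0)).prod (volume.restrict (Set.Ioi 0))) := by
    refine (integrableOn_div_sinh.mul_prod (integrableOn_mul_exp_neg ht)).mono' ?_ ?_
    · apply Measurable.aestronglyMeasurable
      simp only [G, Function.uncurry_def]
      fun_prop
    · rw [Measure.prod_restrict]
      refine (ae_restrict_mem (measurableSet_Ioi.prod measurableSet_Ioi)).mono ?_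
      rintro ⟨x, u⟩ ⟨hx, hu⟩
      have hx : 0 < x := hx
      have hu : 0 < u := hu
      have hs : 0 < Real.sinh (π * x / 2) := Real.sinh_pos_iff.2 (by positivity)
      have hsin : |Real.sin (x * u)| ≤ x * u := by
        simpa [abs_of_pos (mul_pos hx hu)] using Real.abs_sin_le_abs (x := x * u)
      simp only [G, Function.uncurry_apply_pair, norm_div, norm_mul, Real.norm_eq_abs,
        Real.abs_exp, abs_of_pos hs]
      calc _ ≤ Real.exp (-t * u) * (x * u) / Real.sinh (π * x / 2) := by gcongr
        _ = _ := by ring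
  have hswap := integral_integral_swap hG
  calc _ = ∫ x in Set.Ioi (0 : ℝ), ∫ u in Set.Ioi (0 : ℝ), G x u := by
        congr 1 with x
        simp only [G]
        rw [integral_div, integral_exp_neg_mul_sin ht, div_div]
    _ = _ := hswap
    _ = _ := by
        refine setIntegral_congr_fun measurableSet_Ioi fun u hu => ?_
        simp only [G, mul_div_assoc (Real.exp _)]
        rw [integral_const_mul, ← integral_sin_div_sinh hu]
        simp only [mul_comm u]

theorem mul_integral_exp_neg_mul_tanh {t : ℝ} (ht : 0 < t) :
    t * ∫ u in Set.Ioi (0 : ℝ), Real.exp (-t * u) * Real.tanh u = t * betaFn (t / 2) - 1 := by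
  have hexp := integrableOn_exp_mul_Ioi (a := -t) (by linarith) 0
  have hb : IntegrableOn (fun u => Real.exp (-t * u) / (1 + Real.exp (-(2 * u)))) (Set.Ioi 0) := by
    refine hexp.mono' ?_ (.of_forall fun u => ?_)
    · apply Measurable.aestronglyMeasurable; fun_prop
    · have := Real.exp_pos (-(2 * u))
      rw [Real.norm_of_nonneg (by positivity)]
      exact div_le_self (Real.exp_pos _).le (by linarith)
  have hsub : betaFn (t / 2) =
      2 * ∫ u in Set.Ioi (0 : ℝ), Real.exp (-t * u) / (1 + Real.exp (-(2 * u))) := by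
    have := integral_comp_mul_left_Ioi
      (fun s => Real.exp (-(t / 2) * s) / (1 + Real.exp (-s))) 0 (b := 2) two_pos
    rw [mul_zero, smul_eq_mul] at this
    rw [betaFn, ← mul_inv_cancel_left₀ (two_ne_zero' ℝ) (∫ s in Set.Ioi (0 : ℝ), _), ← this]
    congr! 4 with u
    ring_nf
  have htanh : ∀ u : ℝ, Real.exp (-t * u) * Real.tanh u =
      2 * (Real.exp (-t * u) / (1 + Real.exp (-(2 * u)))) - Real.exp (-t * u) := by
    intro u
    have h1 := Real.exp_pos u
    have h2 := Real.exp_pos (-u)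
    have h3 : Real.exp u * Real.exp (-u) = 1 := by rw [← Real.exp_add]; simp
    rw [Real.tanh_eq_sinh_div_cosh, Real.sinh_eq, Real.cosh_eq,
      show -(2 * u) = -u + -u by ring, Real.exp_add]
    field_simp
    linear_combination (2 * Real.exp (-u)) * h3
  simp_rw [htanh]
  rw [integral_sub (hb.const_mul 2) hexp, integral_const_mul, ← hsub,
    integral_exp_mul_Ioi (by linarith)]
  simp
  field_simp

/-- For every `t > 0`,
`i(1 - t β(t/2)) = ∫_ℝ (1 + itx)/(it - x) · (1/2)|x|/((1+x²) sinh(π|x|/2)) dx`. -/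
theorem voiculescu_cosh_representation (t : ℝ) (ht : 0 < t) :
    Complex.I * (1 - (t : ℂ) * (betaFn (t / 2) : ℂ)) =
      ∫ x : ℝ, (1 + Complex.I * t * x) / (Complex.I * t - x) *
        (((1 / 2) * |x| / ((1 + x ^ 2) * Real.sinh (Real.pi * |x| / 2)) : ℝ) : ℂ) := by
  let g : ℝ → ℝ := fun x => |x| / ((t ^ 2 + x ^ 2) * Real.sinh (π * |x| / 2))
  let h : ℝ → ℝ := fun x => x / (1 + x ^ 2) * g x
  have hgnn : ∀ x, 0 ≤ g x := fun x => by
    have : 0 ≤ Real.sinh (π * |x| / 2) := Real.sinh_nonneg_iff.2 (by positivity)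
    positivity
  have hg : Integrable g := by
    have h0 := ((integrable_inv_one_add_sq.comp_mul_left' (R := t⁻¹)
      (by positivity)).const_mul (2 / π * (t ^ 2)⁻¹))
    refine h0.mono' (by simp only [g]; apply Measurable.aestronglyMeasurable; fun_prop)
      (.of_forall fun x => ?_)
    rw [Real.norm_of_nonneg (hgnn x)]
    rcases eq_or_ne x 0 with rfl | hx
    · simp [g]; positivity
    have hx' : 0 < |x| := abs_pos.2 hx
    have hs : π * |x| / 2 ≤ Real.sinh (π * |x| / 2) := Real.self_le_sinh_iff.2 (by positivity)
    calc g x ≤ |x| / ((t ^ 2 + x ^ 2) * (π * |x| / 2)) := by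
          simp only [g]; gcongr
      _ = _ := by field_simp
  have hh : Integrable h := by
    refine hg.bdd_mul (c := 1) (by apply Measurable.aestronglyMeasurable; fun_prop)
      (.of_forall fun x => ?_)
    rw [norm_div, Real.norm_eq_abs, Real.norm_of_nonneg (by positivity),
      div_le_one (by positivity)]
    nlinarith [sq_abs x, sq_nonneg (|x| - 1), abs_nonneg x]
  have hhodd : ∫ x, h x = 0 := by
    have h1 := integral_neg_eq_self h volume
    have h2 : ∀ x, h (-x) = -h x := fun x => by simp [h, g, neg_div]
    simp_rw [h2] at h1
    rw [integral_neg] at h1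
    linarith
  have hgint : ∫ x, g x = 2 * ∫ u in Set.Ioi (0 : ℝ), Real.exp (-t * u) * Real.tanh u := by
    rw [← integral_div_sinh_eq ht,
      ← integral_comp_abs (f := fun x => x / ((t ^ 2 + x ^ 2) * Real.sinh (π * x / 2)))]
    simp only [g, sq_abs]
  have hdecomp : ∀ x : ℝ, (1 + Complex.I * t * x) / (Complex.I * t - x) *
        (((1 / 2) * |x| / ((1 + x ^ 2) * Real.sinh (Real.pi * |x| / 2)) : ℝ) : ℂ) =
      -(Complex.I * t / 2) * (g x : ℂ) + ((t ^ 2 - 1) / 2) * (h x : ℂ) := by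
    intro x
    have hne : Complex.I * t - x ≠ 0 := fun h0 => by
      have := congrArg Complex.im h0
      simp [ht.ne'] at this
    have hq : ((t : ℂ) ^ 2 + x ^ 2) ≠ 0 := by
      exact_mod_cast (show 0 < t ^ 2 + x ^ 2 by positivity).ne'
    have h1 : (1 + (x : ℂ) ^ 2) ≠ 0 := by
      exact_mod_cast (show 0 < 1 + x ^ 2 by positivity).ne'
    have hfrac : (1 + Complex.I * t * x) / (Complex.I * t - x) =
        (-(Complex.I * t) * (1 + x ^ 2) + x * (t ^ 2 - 1)) / (t ^ 2 + x ^ 2) := by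
      rw [div_eq_div_iff hne hq]
      linear_combination (t ^ 2 * (1 + x ^ 2) : ℂ) * Complex.I_sq
    rw [hfrac]
    simp only [g, h]
    push_cast
    generalize Complex.sinh (π * (|x| : ℝ) / 2) = S
    rcases eq_or_ne S 0 with rfl | hS
    · simp
    field_simp
  simp_rw [hdecomp]
  rw [integral_add (hg.ofReal.const_mul _) (hh.ofReal.const_mul _), integral_const_mul,
    integral_const_mul, integral_complex_ofReal, integral_complex_ofReal, hhodd, hgint]
  have := congrArg (fun r : ℝ => (r : ℂ)) (mul_integral_exp_neg_mul_tanh ht)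
  push_cast at this ⊢
  linear_combination Complex.I * this
end

section
/- For every real s > 0, ∫_0^∞ cos(sx) · x / ((1 + x²)·sinh(πx/2)) dx = 2·sinh(s)·arctan(e^{-s}) + (π/2)·e^{-s} - 1. -/
open MeasureTheory Set Filter Topology

theorem integral_Ioi_mul_exp_neg_mul {a : ℝ} (ha : 0 < a) :
    ∫ x in Ioi (0 : ℝ), x * Real.exp (-(a * x)) = 1 / a ^ 2 := by
  have h := Real.integral_rpow_mul_exp_neg_mul_Ioi (a := 2) two_pos ha
  rw [Real.Gamma_two, mul_one, Real.rpow_two, one_div_pow] at h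
  rw [← h]
  norm_num

theorem integrableOn_Ioi_mul_exp_neg_mul {a : ℝ} (ha : 0 < a) :
    IntegrableOn (fun x : ℝ => x * Real.exp (-(a * x))) (Ioi 0) := by
  apply Integrable.of_integral_ne_zero
  rw [integral_Ioi_mul_exp_neg_mul ha]
  positivity

theorem norm_ofReal_mul_cexp_neg_mul (b : ℂ) (x : ℝ) :
    ‖(x : ℂ) * Complex.exp (-b * x)‖ = ‖x * Real.exp (-(b.re * x))‖ := by
  simp [Complex.norm_exp]

theorem integrableOn_Ioi_mul_cexp_neg_mul {b : ℂ} (hb : 0 < b.re) :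
    IntegrableOn (fun x : ℝ => (x : ℂ) * Complex.exp (-b * x)) (Ioi 0) :=
  (integrableOn_Ioi_mul_exp_neg_mul hb).congr' (by fun_prop)
    (ae_of_all _ fun x => (norm_ofReal_mul_cexp_neg_mul b x).symm)

theorem integral_Ioi_mul_cexp_neg_mul {b : ℂ} (hb : 0 < b.re) :
    ∫ x in Ioi (0 : ℝ), (x : ℂ) * Complex.exp (-b * x) = 1 / b ^ 2 := by
  have hb0 : b ≠ 0 := by rintro rfl; simp at hb
  have hderiv : ∀ x ∈ Ici (0 : ℝ), HasDerivAt
      (fun x : ℝ => -((x : ℂ) * Complex.exp (-b * x)) / b - Complex.exp (-b * x) / b ^ 2)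
      ((x : ℂ) * Complex.exp (-b * x)) x := by
    intro x _
    have h1 : HasDerivAt (fun x : ℝ => (x : ℂ)) 1 x := Complex.ofRealCLM.hasDerivAt
    have h2 := (h1.const_mul (-b)).cexp
    refine (((h1.mul h2).neg.div_const b).sub (h2.div_const (b ^ 2))).congr_deriv ?_
    field_simp
    ring
  have hexp : Tendsto (fun x : ℝ => Complex.exp (-b * x)) atTop (𝓝 0) := by
    rw [tendsto_zero_iff_norm_tendsto_zero]
    simp only [Complex.norm_exp, Complex.mul_re, Complex.neg_re, Complex.ofReal_re,
      Complex.ofReal_im, mul_zero, sub_zero, neg_mul]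
    exact Real.tendsto_exp_neg_atTop_nhds_zero.comp (tendsto_id.const_mul_atTop hb)
  have hmul : Tendsto (fun x : ℝ => (x : ℂ) * Complex.exp (-b * x)) atTop (𝓝 0) := by
    rw [tendsto_zero_iff_norm_tendsto_zero]
    simp only [norm_ofReal_mul_cexp_neg_mul]
    rw [← tendsto_zero_iff_norm_tendsto_zero]
    have h := ((Real.tendsto_pow_mul_exp_neg_atTop_nhds_zero 1).comp
      (tendsto_id.const_mul_atTop hb)).div_const b.re
    refine (zero_div b.re ▸ h).congr fun x => ?_
    simp
    field_simp
  rw [integral_Ioi_of_hasDerivAt_of_tendsto' hderiv (integrableOn_Ioi_mul_cexp_neg_mul hb)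
    ((hmul.neg.div_const b).sub (hexp.div_const (b ^ 2)))]
  simp

theorem re_mul_cexp_neg_mul (a t x : ℝ) :
    (x * Complex.exp (-(a + t * Complex.I) * x) : ℂ).re =
      x * Real.exp (-(a * x)) * Real.cos (t * x) := by
  simp [Complex.exp_re, mul_assoc]

theorem integral_Ioi_mul_exp_neg_mul_mul_cos {a : ℝ} (ha : 0 < a) (t : ℝ) :
    ∫ x in Ioi (0 : ℝ), x * Real.exp (-(a * x)) * Real.cos (t * x) =
      (1 / (a + t * Complex.I : ℂ) ^ 2).re := by
  have hb : 0 < (a + t * Complex.I : ℂ).re := by simpa using ha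
  rw [← integral_Ioi_mul_cexp_neg_mul hb]
  simp only [← re_mul_cexp_neg_mul]
  exact integral_re (integrableOn_Ioi_mul_cexp_neg_mul hb)

theorem integral_Ioi_exp_neg_mul_cos (x : ℝ) :
    ∫ u in Ioi (0 : ℝ), Real.exp (-u) * Real.cos (x * u) = 1 / (1 + x ^ 2) := by
  have hb : (-1 + x * Complex.I : ℂ).re < 0 := by simp
  have h := integral_re (integrableOn_exp_mul_complex_Ioi hb 0)
  rw [integral_exp_mul_complex_Ioi hb 0] at h
  simp only [RCLike.re_eq_complex_re, Complex.exp_re] at h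
  simp [Complex.div_re, Complex.normSq_apply] at h
  rw [h]
  ring

theorem tsum_int_one_div_add_sq (z : UpperHalfPlane) :
    ∑' n : ℤ, 1 / ((z : ℂ) + n) ^ 2 =
      -4 * Real.pi ^ 2 * (Complex.exp (2 * Real.pi * Complex.I * z) /
        (1 - Complex.exp (2 * Real.pi * Complex.I * z)) ^ 2) := by
  have h := EisensteinSeries.qExpansion_identity le_rfl z
  rw [show 1 + 1 = 2 from rfl] at h
  simp only [pow_one] at h
  rw [h, (hasSum_coe_mul_geometric_of_norm_lt_one
    (UpperHalfPlane.norm_exp_two_pi_I_lt_one z)).tsum_eq, mul_pow, mul_pow, Complex.I_sq]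
  norm_num

theorem hasSum_re_one_div_half_odd_pi_add_sq {t : ℝ} (ht : 0 < t) :
    HasSum (fun n : ℕ => 2 * (1 / (((2 * n + 1) * (Real.pi / 2) : ℝ) + t * Complex.I : ℂ) ^ 2).re)
      (1 / Real.cosh t ^ 2) := by
  have hpi : (Real.pi : ℂ) ≠ 0 := by exact_mod_cast Real.pi_ne_zero
  let z : UpperHalfPlane := ⟨1 / 2 + (t / Real.pi : ℝ) * Complex.I, by
    have : 0 < t / Real.pi := by positivity
    simpa using this⟩
  have hz : (z : ℂ) = 1 / 2 + (t / Real.pi : ℝ) * Complex.I := rfl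
  have hsum : Summable fun n : ℤ => 1 / ((z : ℂ) + n) ^ 2 := by
    have h := EisensteinSeries.linear_right_summable z 1 (k := 2) le_rfl
    refine h.congr fun n => ?_
    simp [zpow_ofNat]
  have hq : Complex.exp (2 * Real.pi * Complex.I * z) = -Real.exp (-(2 * t)) := by
    rw [hz]
    have : 2 * Real.pi * Complex.I * (1 / 2 + (t / Real.pi : ℝ) * Complex.I) =
        Real.pi * Complex.I + (-(2 * t) : ℝ) := by
      push_cast
      field_simp
      linear_combination (2 * t : ℂ) * Complex.I_sq
    rw [this, Complex.exp_add, Complex.exp_pi_mul_I]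
    push_cast
    ring
  have hint := hsum.hasSum
  rw [tsum_int_one_div_add_sq, hq] at hint
  have hre := (Complex.hasSum_re (hint.nat_add_neg_add_one)).mul_left (1 / Real.pi ^ 2)
  convert! hre using 1
  · ext n
    have e1 : ((z : ℂ) + (n : ℤ)) =
        (((2 * n + 1) * (Real.pi / 2) : ℝ) + t * Complex.I) / Real.pi := by
      rw [hz]; push_cast; field_simp; ring
    have e2 : ((z : ℂ) + (-(n + 1 : ℤ) : ℤ)) =
        -(starRingEnd ℂ) ((((2 * n + 1) * (Real.pi / 2) : ℝ) + t * Complex.I) / Real.pi) := by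
      rw [hz]
      simp only [map_div₀, map_add, map_mul, Complex.conj_ofReal, Complex.conj_I]
      push_cast; field_simp; ring
    rw [e1, e2, neg_sq, ← map_pow, ← map_one (starRingEnd ℂ), ← map_div₀, Complex.add_re,
      Complex.conj_re, map_one, div_pow, one_div_div, ← Complex.ofReal_pow,
      div_eq_mul_one_div ((Real.pi ^ 2 : ℝ) : ℂ), Complex.re_ofReal_mul]
    field_simp
    ring
  · have : (-4 * (Real.pi : ℂ) ^ 2 * (-(Real.exp (-(2 * t)) : ℂ) /
        (1 - -(Real.exp (-(2 * t)) : ℂ)) ^ 2)) =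
        ((4 * Real.pi ^ 2 * (Real.exp (-(2 * t)) / (1 + Real.exp (-(2 * t))) ^ 2) : ℝ) : ℂ) := by
      push_cast; ring
    rw [this, Complex.ofReal_re, Real.cosh_eq, show -(2 * t) = -t + -t by ring, Real.exp_add,
      Real.exp_neg]
    have := Real.exp_pos t
    field_simp
    ring

theorem hasSum_mul_exp_neg_half_odd_pi {x : ℝ} (hx : 0 < x) :
    HasSum (fun n : ℕ => 2 * (x * Real.exp (-((2 * n + 1) * (Real.pi / 2) * x))))
      (x / Real.sinh (Real.pi * x / 2)) := by
  set y := Real.pi * x / 2 with hy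
  have hy0 : 0 < y := by positivity
  have hlt : Real.exp (-(2 * y)) < 1 := by simpa using hy0
  have h := (hasSum_geometric_of_lt_one (Real.exp_pos _).le hlt).mul_left
    (2 * x * Real.exp (-y))
  convert! h using 1
  · ext n
    rw [← Real.exp_nat_mul, mul_assoc _ (Real.exp (-y)), ← Real.exp_add, hy]
    ring_nf
  · have h1 : Real.exp (-(2 * y)) = Real.exp (-y) * Real.exp (-y) := by
      rw [← Real.exp_add]; ring_nf
    have h2 : 1 - Real.exp (-(2 * y)) ≠ 0 := by linarith
    have h3 : Real.sinh y ≠ 0 := (Real.sinh_pos_iff.2 hy0).ne'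
    rw [← div_eq_mul_inv, div_eq_div_iff h3 h2, h1, Real.sinh_eq]
    have : Real.exp y * Real.exp (-y) = 1 := by rw [← Real.exp_add]; simp
    linear_combination (-x) * this

theorem half_exp_le_cosh (x : ℝ) : Real.exp x / 2 ≤ Real.cosh x := by
  rw [Real.cosh_eq]
  linarith [Real.exp_pos (-x)]

theorem norm_div_sinh_le {x : ℝ} (hx : 0 < x) :
    ‖x / Real.sinh (Real.pi * x / 2)‖ ≤ ‖4 / Real.pi * Real.exp (-(Real.pi / 4) * x)‖ := by
  have hs : 0 < Real.sinh (Real.pi * x / 2) := Real.sinh_pos_iff.2 (by positivity)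
  rw [Real.norm_of_nonneg (by positivity), Real.norm_of_nonneg (by positivity),
    div_le_iff₀ hs]
  have h2 : Real.sinh (Real.pi * x / 2) =
      2 * Real.sinh (Real.pi / 4 * x) * Real.cosh (Real.pi / 4 * x) := by
    rw [← Real.sinh_two_mul]; ring_nf
  have h3 : Real.pi / 4 * x ≤ Real.sinh (Real.pi / 4 * x) :=
    Real.self_le_sinh_iff.2 (by positivity)
  have h4 := half_exp_le_cosh (Real.pi / 4 * x)
  calc x = 4 / Real.pi * Real.exp (-(Real.pi / 4) * x) *
        (2 * (Real.pi / 4 * x) * (Real.exp (Real.pi / 4 * x) / 2)) := by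
        have := Real.pi_ne_zero
        field_simp
        rw [← Real.exp_add]
        simp
    _ ≤ _ := by rw [h2]; gcongr

theorem integrableOn_Ioi_div_sinh :
    IntegrableOn (fun x : ℝ => x / Real.sinh (Real.pi * x / 2)) (Ioi 0) := by
  have h := (integrableOn_exp_mul_Ioi (a := -(Real.pi / 4))
    (by linarith [Real.pi_pos]) 0).const_mul (4 / Real.pi)
  refine h.mono (Measurable.aestronglyMeasurable (by fun_prop)) ?_
  filter_upwards [ae_restrict_mem measurableSet_Ioi] with x hx
  exact norm_div_sinh_le hx

theorem integral_Ioi_div_sinh_mul_cos_of_pos {t : ℝ} (ht : 0 < t) :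
    ∫ x in Ioi (0 : ℝ), x / Real.sinh (Real.pi * x / 2) * Real.cos (t * x) =
      1 / Real.cosh t ^ 2 := by
  have ha (n : ℕ) : 0 < (2 * n + 1) * (Real.pi / 2) := by positivity
  let F (n : ℕ) (x : ℝ) : ℝ :=
    2 * (x * Real.exp (-((2 * n + 1) * (Real.pi / 2) * x)) * Real.cos (t * x))
  have hF (n : ℕ) : IntegrableOn (F n) (Ioi 0) := by
    refine Integrable.const_mul ?_ 2
    exact (integrableOn_Ioi_mul_exp_neg_mul (ha n)).mul_bdd (c := 1) (by fun_prop)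
      (ae_of_all _ fun x => by simpa using Real.abs_cos_le_one (t * x))
  have hS : Summable fun n => ∫ x in Ioi (0 : ℝ), ‖F n x‖ := by
    have h1 : Summable fun n : ℕ => 2 * (1 / ((2 * n + 1) * (Real.pi / 2)) ^ 2) := by
      have h := ((summable_nat_add_iff 1).2
        (Real.summable_one_div_nat_pow.2 one_lt_two)).mul_left 2
      refine Summable.of_nonneg_of_le (fun n => by positivity) (fun n => ?_) h
      gcongr
      push_cast
      nlinarith [Real.pi_gt_three, (Nat.cast_nonneg n : (0 : ℝ) ≤ n)]
    refine Summable.of_nonneg_of_le (fun n => by positivity) (fun n => ?_) h1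
    rw [← integral_Ioi_mul_exp_neg_mul (ha n), ← integral_const_mul]
    refine setIntegral_mono_on (hF n).norm
      ((integrableOn_Ioi_mul_exp_neg_mul (ha n)).const_mul 2) measurableSet_Ioi fun x hx => ?_
    have hx : 0 < x := hx
    simp only [F, norm_mul, Real.norm_eq_abs, Real.abs_exp, abs_of_pos hx, abs_two]
    have := Real.abs_cos_le_one (t * x)
    have : 0 < x * Real.exp (-((2 * n + 1) * (Real.pi / 2) * x)) := by positivity
    nlinarith
  have h := hasSum_integral_of_summable_integral_norm hF hS
  have heq : ∫ x in Ioi (0 : ℝ), ∑' n, F n x =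
      ∫ x in Ioi (0 : ℝ), x / Real.sinh (Real.pi * x / 2) * Real.cos (t * x) := by
    refine setIntegral_congr_fun measurableSet_Ioi fun x hx => ?_
    refine HasSum.tsum_eq ?_
    simpa only [F, mul_assoc] using (hasSum_mul_exp_neg_half_odd_pi hx).mul_right (Real.cos (t * x))
  rw [heq] at h
  refine h.unique ?_
  simpa only [F, integral_const_mul, integral_Ioi_mul_exp_neg_mul_mul_cos (ha _)]
    using hasSum_re_one_div_half_odd_pi_add_sq ht

theorem integral_Ioi_div_sinh_mul_cos {t : ℝ} (ht : t ≠ 0) :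
    ∫ x in Ioi (0 : ℝ), x / Real.sinh (Real.pi * x / 2) * Real.cos (t * x) =
      1 / Real.cosh t ^ 2 := by
  rw [← Real.cosh_abs, ← integral_Ioi_div_sinh_mul_cos_of_pos (abs_pos.2 ht)]
  refine setIntegral_congr_fun measurableSet_Ioi fun x hx => ?_
  have hx : 0 < x := hx
  rw [← Real.cos_abs (t * x), abs_mul, abs_of_pos hx]

section

variable (c : ℝ)

theorem hasDerivAt_exp_mul_inv_cosh_sub_arctan (u : ℝ) :
    HasDerivAt (fun u => Real.exp c *
        ((Real.cosh (c + u))⁻¹ - 2 * Real.arctan (Real.exp (-(c + u)))))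
      (Real.exp (-u) * (1 / Real.cosh (c + u) ^ 2)) u := by
  have hc := (Real.cosh_pos (c + u)).ne'
  have h0 : HasDerivAt (fun u => c + u) 1 u := (hasDerivAt_id u).const_add c
  refine (((h0.cosh.inv hc).sub (h0.neg.exp.arctan.const_mul 2)).const_mul
    (Real.exp c)).congr_deriv ?_
  have h1 : 2 * (1 / (1 + Real.exp (-(c + u)) ^ 2) * (Real.exp (-(c + u)) * -1)) =
      -(Real.cosh (c + u))⁻¹ := by
    rw [Real.cosh_eq, Real.exp_neg]
    have := Real.exp_pos (c + u)
    field_simp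
  have h2 : Real.exp (-u) = Real.exp c * (Real.cosh (c + u) - Real.sinh (c + u)) := by
    rw [Real.cosh_sub_sinh, ← Real.exp_add]
    ring_nf
  simp only [Pi.neg_apply]
  rw [h1, h2]
  field_simp
  ring

theorem tendsto_exp_mul_inv_cosh_sub_arctan :
    Tendsto (fun u => Real.exp c *
      ((Real.cosh (c + u))⁻¹ - 2 * Real.arctan (Real.exp (-(c + u))))) atTop (𝓝 0) := by
  have h0 : Tendsto (fun u => c + u) atTop atTop := tendsto_atTop_add_const_left _ c tendsto_id
  have h1 : Tendsto (fun u => (Real.cosh (c + u))⁻¹) atTop (𝓝 0) :=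
    tendsto_inv_atTop_zero.comp (tendsto_atTop_mono
      (fun u => half_exp_le_cosh (c + u)) ((Real.tendsto_exp_atTop.comp h0).atTop_div_const two_pos))
  have h2 := (Real.continuous_arctan.tendsto 0).comp (Real.tendsto_exp_neg_atTop_nhds_zero.comp h0)
  simpa using (h1.sub (h2.const_mul 2)).const_mul (Real.exp c)

theorem integrableOn_Ioi_exp_neg_mul_one_div_cosh_sq :
    IntegrableOn (fun u => Real.exp (-u) * (1 / Real.cosh (c + u) ^ 2)) (Ioi 0) :=
  integrableOn_Ioi_deriv_of_nonneg' (fun u _ => hasDerivAt_exp_mul_inv_cosh_sub_arctan c u)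
    (fun u _ => by positivity) (tendsto_exp_mul_inv_cosh_sub_arctan c)

theorem integral_Ioi_exp_neg_mul_one_div_cosh_sq :
    ∫ u in Ioi (0 : ℝ), Real.exp (-u) * (1 / Real.cosh (c + u) ^ 2) =
      Real.exp c * (2 * Real.arctan (Real.exp (-c)) - (Real.cosh c)⁻¹) := by
  rw [integral_Ioi_of_hasDerivAt_of_nonneg'
    (fun u _ => hasDerivAt_exp_mul_inv_cosh_sub_arctan c u)
    (fun u _ => by positivity) (tendsto_exp_mul_inv_cosh_sub_arctan c)]
  simp only [add_zero]
  ring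

end

theorem integral_Ioi_cos_mul_div_eq_integral_one_div_cosh_sq (s : ℝ) :
    ∫ x in Ioi (0 : ℝ), Real.cos (s * x) * x / ((1 + x ^ 2) * Real.sinh (Real.pi * x / 2)) =
      ∫ u in Ioi (0 : ℝ), Real.exp (-u) *
        ((1 / Real.cosh (s + u) ^ 2 + 1 / Real.cosh (-s + u) ^ 2) / 2) := by
  let K (x u : ℝ) : ℝ := Real.cos (s * x) * Real.cos (x * u) *
    (x / Real.sinh (Real.pi * x / 2) * Real.exp (-u))
  have hK : Integrable (Function.uncurry K)
      ((volume.restrict (Ioi 0)).prod (volume.restrict (Ioi 0))) := by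
    refine (integrableOn_Ioi_div_sinh.mul_prod (integrableOn_exp_neg_Ioi 0)).bdd_mul (c := 1)
      (Continuous.aestronglyMeasurable (by fun_prop)) (ae_of_all _ fun p => ?_)
    rw [norm_mul]
    exact mul_le_one₀ (Real.abs_cos_le_one _) (norm_nonneg _) (Real.abs_cos_le_one _)
  have hint (t : ℝ) : IntegrableOn
      (fun x : ℝ => x / Real.sinh (Real.pi * x / 2) * Real.cos (t * x)) (Ioi 0) :=
    Integrable.mul_bdd (c := 1) integrableOn_Ioi_div_sinh (by fun_prop)
      (ae_of_all _ fun x => Real.abs_cos_le_one (t * x))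
  calc _ = ∫ x in Ioi (0 : ℝ), ∫ u in Ioi (0 : ℝ), K x u := by
        congr 1 with x
        have h (u : ℝ) : K x u = Real.cos (s * x) * (x / Real.sinh (Real.pi * x / 2)) *
          (Real.exp (-u) * Real.cos (x * u)) := by simp only [K]; ring
        simp only [h, integral_const_mul, integral_Ioi_exp_neg_mul_cos]
        rw [mul_one_div, mul_div_assoc', div_div, mul_comm (1 + x ^ 2)]
    _ = ∫ u in Ioi (0 : ℝ), ∫ x in Ioi (0 : ℝ), K x u := integral_integral_swap hK
    _ = _ := by
        refine integral_congr_ae (ae_restrict_of_ae ?_)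
        filter_upwards [Measure.ae_ne volume s, Measure.ae_ne volume (-s)] with u h1 h2
        have h (x : ℝ) : K x u = Real.exp (-u) / 2 *
            (x / Real.sinh (Real.pi * x / 2) * Real.cos ((s + u) * x) +
              x / Real.sinh (Real.pi * x / 2) * Real.cos ((-s + u) * x)) := by
          have e1 : (s + u) * x = s * x + x * u := by ring
          have e2 : (-s + u) * x = -(s * x - x * u) := by ring
          simp only [K]
          rw [e1, e2, Real.cos_neg, Real.cos_add, Real.cos_sub]
          ring
        simp only [h]
        rw [integral_const_mul, integral_add (hint _) (hint _),
          integral_Ioi_div_sinh_mul_cos (fun h => h2 (by linarith)),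
          integral_Ioi_div_sinh_mul_cos (fun h => h1 (by linarith))]
        ring

/-- For every real `s > 0`,
`∫_0^∞ cos(sx) · x/((1+x²) sinh(πx/2)) dx = 2 sinh(s) arctan(e^{-s}) + (π/2) e^{-s} - 1`. -/
theorem cosineTransform_cosh_khintchine (s : ℝ) (hs : 0 < s) :
    ∫ x in Set.Ioi (0 : ℝ), Real.cos (s * x) * x / ((1 + x ^ 2) * Real.sinh (Real.pi * x / 2)) =
      2 * Real.sinh s * Real.arctan (Real.exp (-s)) + Real.pi / 2 * Real.exp (-s) - 1 := by
  have h (u : ℝ) : Real.exp (-u) *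
      ((1 / Real.cosh (s + u) ^ 2 + 1 / Real.cosh (-s + u) ^ 2) / 2) =
      (Real.exp (-u) * (1 / Real.cosh (s + u) ^ 2) +
        Real.exp (-u) * (1 / Real.cosh (-s + u) ^ 2)) / 2 := by ring
  rw [integral_Ioi_cos_mul_div_eq_integral_one_div_cosh_sq]
  simp only [h]
  rw [integral_div, integral_add (integrableOn_Ioi_exp_neg_mul_one_div_cosh_sq s)
    (integrableOn_Ioi_exp_neg_mul_one_div_cosh_sq (-s)),
    integral_Ioi_exp_neg_mul_one_div_cosh_sq, integral_Ioi_exp_neg_mul_one_div_cosh_sq,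
    neg_neg, Real.cosh_neg]
  have harctan : Real.arctan (Real.exp s) = Real.pi / 2 - Real.arctan (Real.exp (-s)) := by
    rw [← Real.arctan_inv_of_pos (Real.exp_pos _), Real.exp_neg, inv_inv]
  have hcosh : (Real.exp s + Real.exp (-s)) * (Real.cosh s)⁻¹ = 2 := by
    rw [Real.cosh_eq]
    have := Real.exp_pos s
    have := Real.exp_pos (-s)
    field_simp
  rw [harctan, Real.sinh_eq]
  linear_combination (-1 / 2) * hcosh
end

section
/- ∫_0^∞ x / ((1 + x²)·sinh(πx/2)) dx = π/2 - 1. -/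
open Filter Topology MeasureTheory Finset

/-- Mittag-Leffler expansion of the hyperbolic cotangent. -/
theorem tendsto_sum_coth {y : ℝ} (hy : 0 < y) :
    Tendsto (fun n : ℕ => ∑ j ∈ range n, 2 * y / (y ^ 2 + ((j : ℝ) + 1) ^ 2)) atTop
      (𝓝 (Real.pi * (Real.cosh (Real.pi * y) / Real.sinh (Real.pi * y)) - 1 / y)) := by
  have hmem : (y * Complex.I : ℂ) ∈ Complex.integerComplement := by
    rintro ⟨n, hn⟩
    have := congrArg Complex.im hn
    simp at this
    exact hy.ne this
  have h := (tendsto_logDeriv_euler_cot_sub hmem).const_mul Complex.I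
  have hy' : (y : ℂ) ≠ 0 := by exact_mod_cast hy.ne'
  have hs : Complex.sinh (Real.pi * y) ≠ 0 := by
    exact_mod_cast (Real.sinh_pos_iff.2 (mul_pos Real.pi_pos hy)).ne'
  rw [Complex.isometry_ofReal.isEmbedding.tendsto_nhds_iff]
  convert h using 2 with n
  · rw [Function.comp_apply, Complex.ofReal_sum, mul_sum]
    refine sum_congr rfl fun j _ => ?_
    have h1 : (y * Complex.I : ℂ) - (j + 1) ≠ 0 := fun h0 => hy.ne' <| by
      simpa using congrArg Complex.im h0
    have h2 : (y * Complex.I : ℂ) + (j + 1) ≠ 0 := fun h0 => hy.ne' <| by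
      simpa using congrArg Complex.im h0
    have h3 : (y : ℂ) ^ 2 + (j + 1) ^ 2 ≠ 0 := by
      have : (y : ℝ) ^ 2 + ((j : ℝ) + 1) ^ 2 ≠ 0 := by positivity
      exact_mod_cast this
    have h4 : (y : ℂ) ^ 2 + (j + 1) ^ 2
        = -(((y * Complex.I : ℂ) - (j + 1)) * (y * Complex.I + (j + 1))) := by
      linear_combination (y : ℂ) ^ 2 * Complex.I_sq
    have h5 : 1 / ((y * Complex.I : ℂ) - (j + 1)) + 1 / (y * Complex.I + (j + 1))
        = -(2 * (y * Complex.I)) / ((y : ℂ) ^ 2 + (j + 1) ^ 2) := by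
      rw [h4]
      field_simp
      ring
    simp only [cotTerm]
    rw [h5]
    push_cast
    linear_combination (2 * y / ((y : ℂ) ^ 2 + (j + 1) ^ 2)) * Complex.I_sq
  · rw [← mul_assoc, Complex.cot_eq_cos_div_sin, Complex.cos_mul_I, Complex.sin_mul_I]
    push_cast
    field_simp [Complex.I_ne_zero]

/-- Mittag-Leffler expansion of the hyperbolic cosecant, along even partial sums. -/
theorem tendsto_sum_inv_sinh {x : ℝ} (hx : 0 < x) :
    Tendsto (fun N : ℕ => 4 * x *
        ∑ m ∈ range (2 * N), (-1 : ℝ) ^ (m + 1) / (x ^ 2 + 4 * ((m : ℝ) + 1) ^ 2)) atTop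
      (𝓝 (Real.pi / Real.sinh (Real.pi * x / 2) - 2 / x)) := by
  have h1 := tendsto_sum_coth (y := x / 4) (by positivity)
  have h2 := (tendsto_sum_coth (y := x / 2) (by positivity)).comp
    (tendsto_id.const_mul_atTop' (show 0 < 2 by norm_num))
  convert h1.sub h2 using 2 with N
  · simp only [Function.comp, id]
    induction N with
    | zero => simp
    | succ N ih =>
      rw [show 2 * (N + 1) = 2 * N + 1 + 1 by ring, sum_range_succ, sum_range_succ,
        sum_range_succ, sum_range_succ, sum_range_succ, mul_add, mul_add, ih]
      have e1 : (-1 : ℝ) ^ (2 * N + 1 + 1) = 1 := by simp [pow_succ, pow_mul]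
      have e2 : (-1 : ℝ) ^ (2 * N + 1) = -1 := by simp [pow_succ, pow_mul]
      rw [e1, e2]
      push_cast
      have a1 : x ^ 2 + 4 * (2 * (N : ℝ) + 1) ^ 2 ≠ 0 := by positivity
      have a2 : x ^ 2 + 4 * (2 * (N : ℝ) + 1 + 1) ^ 2 ≠ 0 := by positivity
      have b1 : 2 * (x / 4) / ((x / 4) ^ 2 + ((N : ℝ) + 1) ^ 2)
          = 8 * x / (x ^ 2 + 4 * (2 * (N : ℝ) + 1 + 1) ^ 2) := by
        rw [div_eq_div_iff (by positivity) a2]; ring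
      have b2 : 2 * (x / 2) / ((x / 2) ^ 2 + (2 * (N : ℝ) + 1) ^ 2)
          = 4 * x / (x ^ 2 + 4 * (2 * (N : ℝ) + 1) ^ 2) := by
        rw [div_eq_div_iff (by positivity) a1]; ring
      have b3 : 2 * (x / 2) / ((x / 2) ^ 2 + (2 * (N : ℝ) + 1 + 1) ^ 2)
          = 4 * x / (x ^ 2 + 4 * (2 * (N : ℝ) + 1 + 1) ^ 2) := by
        rw [div_eq_div_iff (by positivity) a2]; ring
      rw [b1, b2, b3]
      ring
  · have hs : Real.sinh (Real.pi * (x / 4)) ≠ 0 :=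
      (Real.sinh_pos_iff.2 (by have := Real.pi_pos; positivity)).ne'
    have hc := (Real.cosh_pos (Real.pi * (x / 4))).ne'
    have e : Real.pi * (x / 2) = 2 * (Real.pi * (x / 4)) := by ring
    rw [mul_div_assoc, e, Real.sinh_two_mul, Real.cosh_two_mul]
    have hsq := Real.cosh_sq (Real.pi * (x / 4))
    generalize Real.sinh (Real.pi * (x / 4)) = s at *
    generalize Real.cosh (Real.pi * (x / 4)) = c at *
    field_simp
    linear_combination (-Real.pi * x) * hsq

theorem integrableOn_and_integral_sq_div {c : ℝ} (hc : 1 < c) :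
    IntegrableOn (fun x : ℝ => x ^ 2 / ((x ^ 2 + c ^ 2) * (1 + x ^ 2))) (Set.Ioi 0) ∧
      ∫ x in Set.Ioi (0 : ℝ), x ^ 2 / ((x ^ 2 + c ^ 2) * (1 + x ^ 2)) =
        Real.pi / (2 * (1 + c)) := by
  have hc0 : 0 < c := by linarith
  have hc1 : c ^ 2 - 1 ≠ 0 := by nlinarith
  have hd : ∀ x ∈ Set.Ici (0 : ℝ),
      HasDerivAt (fun x => (c * Real.arctan (x / c) - Real.arctan x) / (c ^ 2 - 1))
        (x ^ 2 / ((x ^ 2 + c ^ 2) * (1 + x ^ 2))) x := by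
    intro x _
    have h1 := ((((hasDerivAt_id x).div_const c).arctan.const_mul c).sub
      (hasDerivAt_id x).arctan).div_const (c ^ 2 - 1)
    refine h1.congr_deriv ?_
    have : 1 + (x / c) ^ 2 = (x ^ 2 + c ^ 2) / c ^ 2 := by field_simp; ring
    simp only [id, this]
    have : x ^ 2 + c ^ 2 ≠ 0 := by positivity
    have : 1 + x ^ 2 ≠ 0 := by positivity
    field_simp
    ring
  have hp : ∀ x ∈ Set.Ioi (0 : ℝ), 0 ≤ x ^ 2 / ((x ^ 2 + c ^ 2) * (1 + x ^ 2)) :=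
    fun x _ => by positivity
  have harctan : Tendsto Real.arctan atTop (𝓝 (Real.pi / 2)) :=
    tendsto_nhds_of_tendsto_nhdsWithin Real.tendsto_arctan_atTop
  have hl : Tendsto (fun x => (c * Real.arctan (x / c) - Real.arctan x) / (c ^ 2 - 1)) atTop
      (𝓝 ((c * (Real.pi / 2) - Real.pi / 2) / (c ^ 2 - 1))) :=
    (((harctan.comp (tendsto_id.atTop_div_const hc0)).const_mul c).sub harctan).div_const _
  refine ⟨integrableOn_Ioi_deriv_of_nonneg' hd hp hl, ?_⟩
  rw [integral_Ioi_of_hasDerivAt_of_nonneg' hd hp hl]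
  have : 1 + c ≠ 0 := by positivity
  simp
  field_simp
  ring

theorem abs_sq_mul_sum_alternating_le (x : ℝ) (N : ℕ) :
    |x ^ 2 * ∑ m ∈ range (2 * N), (-1 : ℝ) ^ (m + 1) / (x ^ 2 + 4 * ((m : ℝ) + 1) ^ 2)| ≤ 1 := by
  set T : ℕ → ℝ :=
    fun N => ∑ m ∈ range (2 * N), (-1 : ℝ) ^ (m + 1) / (x ^ 2 + 4 * ((m : ℝ) + 1) ^ 2)
  have hT : T N ≤ 0 ∧
      -(1 / (x ^ 2 + 4)) + 1 / (x ^ 2 + 4 * (2 * (N : ℝ) + 1) ^ 2) ≤ T N := by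
    induction N with
    | zero => simp [T]
    | succ N ih =>
      have hs : T (N + 1) = T N - 1 / (x ^ 2 + 4 * (2 * (N : ℝ) + 1) ^ 2)
          + 1 / (x ^ 2 + 4 * (2 * (N : ℝ) + 2) ^ 2) := by
        simp only [T]
        rw [show 2 * (N + 1) = 2 * N + 1 + 1 by ring, sum_range_succ, sum_range_succ]
        have e1 : (-1 : ℝ) ^ (2 * N + 1 + 1) = 1 := by simp [pow_succ, pow_mul]
        have e2 : (-1 : ℝ) ^ (2 * N + 1) = -1 := by simp [pow_succ, pow_mul]
        rw [e1, e2]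
        push_cast
        ring
      have d1 : 1 / (x ^ 2 + 4 * (2 * (N : ℝ) + 2) ^ 2)
          ≤ 1 / (x ^ 2 + 4 * (2 * (N : ℝ) + 1) ^ 2) := by
        apply one_div_le_one_div_of_le (by positivity)
        gcongr
        exact one_le_two
      have d2 : 1 / (x ^ 2 + 4 * (2 * ((N + 1 : ℕ) : ℝ) + 1) ^ 2)
          ≤ 1 / (x ^ 2 + 4 * (2 * (N : ℝ) + 2) ^ 2) := by
        apply one_div_le_one_div_of_le (by positivity)
        have : 2 * (N : ℝ) + 2 ≤ 2 * ((N + 1 : ℕ) : ℝ) + 1 := by push_cast; linarith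
        gcongr
      rw [hs]
      constructor <;> linarith [ih.1, ih.2]
  have h1 : 0 ≤ 1 / (x ^ 2 + 4 * (2 * (N : ℝ) + 1) ^ 2) := by positivity
  have h2 : x ^ 2 * (1 / (x ^ 2 + 4)) ≤ 1 := by
    rw [mul_one_div, div_le_one (by positivity)]
    linarith
  change |x ^ 2 * T N| ≤ 1
  rw [abs_le]
  constructor <;> nlinarith [sq_nonneg x, hT.1, hT.2]

/-- `∫_0^∞ x/((1+x²) sinh(πx/2)) dx = π/2 - 1`. -/
theorem integral_cosh_khintchine_total_mass :
    ∫ x in Set.Ioi (0 : ℝ), x / ((1 + x ^ 2) * Real.sinh (Real.pi * x / 2)) =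
      Real.pi / 2 - 1 := by
  have hpi := Real.pi_pos
  set F : ℕ → ℝ → ℝ := fun N x => 2 / Real.pi * (1 + x ^ 2)⁻¹ + 4 / Real.pi *
    ∑ m ∈ range (2 * N), (-1 : ℝ) ^ (m + 1) *
      (x ^ 2 / ((x ^ 2 + (2 * ((m : ℝ) + 1)) ^ 2) * (1 + x ^ 2))) with hF
  have hc (m : ℕ) : (1 : ℝ) < 2 * ((m : ℝ) + 1) := by
    have : (0 : ℝ) ≤ m := m.cast_nonneg
    linarith
  have hFT (N : ℕ) (x : ℝ) : F N x = (1 + x ^ 2)⁻¹ * (2 / Real.pi + 4 / Real.pi * (x ^ 2 *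
      ∑ m ∈ range (2 * N), (-1 : ℝ) ^ (m + 1) / (x ^ 2 + 4 * ((m : ℝ) + 1) ^ 2))) := by
    rw [mul_add, mul_left_comm _ (4 / Real.pi), mul_sum, mul_sum]
    simp only [hF]
    congr 1
    · ring
    · congr 1
      refine sum_congr rfl fun m _ => ?_
      have h1 : x ^ 2 + 4 * ((m : ℝ) + 1) ^ 2 ≠ 0 := by positivity
      have h2 : 1 + x ^ 2 ≠ 0 := by positivity
      rw [mul_pow]
      norm_num
      field_simp
  have hi0 : IntegrableOn (fun x : ℝ => (1 + x ^ 2)⁻¹) (Set.Ioi 0) :=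
    integrable_inv_one_add_sq.integrableOn
  have hi (m : ℕ) := (integrableOn_and_integral_sq_div (hc m)).1.const_mul ((-1 : ℝ) ^ (m + 1))
  have hlim : Tendsto (fun N => ∫ x in Set.Ioi (0 : ℝ), F N x) atTop
      (𝓝 (∫ x in Set.Ioi (0 : ℝ), x / ((1 + x ^ 2) * Real.sinh (Real.pi * x / 2)))) := by
    refine tendsto_integral_of_dominated_convergence
      (fun x => (1 + x ^ 2)⁻¹ * (2 / Real.pi + 4 / Real.pi)) (fun N => ?_) (hi0.mul_const _)
      (fun N => ae_of_all _ fun x => ?_) ?_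
    · exact Measurable.aestronglyMeasurable (by fun_prop)
    · rw [hFT, norm_mul, Real.norm_of_nonneg (by positivity)]
      gcongr
      refine (norm_add_le _ _).trans ?_
      rw [norm_mul, Real.norm_of_nonneg (by positivity : (0 : ℝ) ≤ 2 / Real.pi),
        Real.norm_of_nonneg (by positivity : (0 : ℝ) ≤ 4 / Real.pi)]
      gcongr
      exact mul_le_of_le_one_right (by positivity) (abs_sq_mul_sum_alternating_le x N)
    · refine (ae_restrict_iff' measurableSet_Ioi).2 (ae_of_all _ fun x hx => ?_)
      have hx : 0 < x := hx
      have hs : Real.sinh (Real.pi * x / 2) ≠ 0 := (Real.sinh_pos_iff.2 (by positivity)).ne'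
      have h := (((tendsto_sum_inv_sinh hx).const_mul (x / Real.pi)).const_add
        (2 / Real.pi)).const_mul (1 + x ^ 2)⁻¹
      convert h using 2 with N
      · rw [hFT]; ring
      · have h2 : 1 + x ^ 2 ≠ 0 := by positivity
        field_simp
        ring
  have hval (N : ℕ) : ∫ x in Set.Ioi (0 : ℝ), F N x =
      2 * ∑ i ∈ range (2 * N + 1), (-1 : ℝ) ^ i / (2 * i + 1) - 1 := by
    simp only [hF]
    rw [integral_add (hi0.const_mul _)
      ((integrable_finsetSum _ fun m _ => hi m).const_mul _), integral_const_mul,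
      integral_const_mul, integral_finsetSum _ fun m _ => hi m, integral_Ioi_inv_one_add_sq,
      sum_range_succ']
    simp only [integral_const_mul, (integrableOn_and_integral_sq_div (hc _)).2]
    rw [mul_add, mul_sum, mul_sum, Real.arctan_zero]
    have : ∀ m : ℕ, 4 / Real.pi * ((-1 : ℝ) ^ (m + 1) *
        (Real.pi / (2 * (1 + 2 * ((m : ℝ) + 1))))) =
        2 * ((-1 : ℝ) ^ (m + 1) / (2 * ((m + 1 : ℕ) : ℝ) + 1)) := by
      intro m
      have : 2 * ((m : ℝ) + 1) + 1 ≠ 0 := by positivity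
      have : 1 + 2 * ((m : ℝ) + 1) ≠ 0 := by positivity
      push_cast
      field_simp
      ring
    simp only [this]
    have : 2 / Real.pi * (Real.pi / 2 - 0) = 1 := by field_simp; ring
    rw [this]
    norm_num
    ring
  refine tendsto_nhds_unique hlim ?_
  simp only [hval]
  have h := ((Real.tendsto_sum_pi_div_four.comp (tendsto_atTop_mono
    (fun N : ℕ => (by simp; omega : id N ≤ 2 * N + 1)) tendsto_id)).const_mul 2).sub_const 1
  rwa [show 2 * (Real.pi / 4) - 1 = Real.pi / 2 - 1 by ring] at h
end

section
/- For every real t > 0, i·( 1 + t·∫_0^∞ (1/s - 1/(1 - e^{-s}))·e^{-ts/2} ds ) = ∫_ℝ (1 + itx)/(it - x) · |x| / ((1 + x²)·(e^{π|x|} - 1)) dx, where the integrals are complex-valued. -/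
open MeasureTheory Set

/-- Mittag-Leffler expansion of `coth`, in exponential form. -/
lemma hasSum_one_div_one_sub_exp_neg {s : ℝ} (hs : 0 < s) :
    HasSum (fun n : ℕ => 2 * s / (s ^ 2 + (2 * Real.pi * (n + 1)) ^ 2))
      (1 / (1 - Real.exp (-s)) - 1 / s - 1 / 2) := by
  have hpi : (0 : ℝ) < Real.pi := Real.pi_pos
  have hpc : (Real.pi : ℂ) ≠ 0 := by exact_mod_cast hpi.ne'
  have hsc : (s : ℂ) ≠ 0 := by exact_mod_cast hs.ne'
  set z : ℂ := Complex.I * (s / (2 * Real.pi) : ℝ) with hz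
  have him : 0 < z.im := by
    rw [hz, Complex.I_mul_im, Complex.ofReal_re]; positivity
  have hmem : z ∈ Complex.integerComplement :=
    UpperHalfPlane.coe_mem_integerComplement ⟨z, him⟩
  have hsum := (summable_cotTerm hmem).hasSum
  have hexp : Complex.exp (2 * Real.pi * Complex.I * z) = (Real.exp (-s) : ℝ) := by
    rw [Complex.ofReal_exp]
    congr 1
    rw [hz]
    push_cast
    field_simp
    rw [Complex.I_sq]
  have he1 : (1 - (Real.exp (-s) : ℝ) : ℂ) ≠ 0 := by
    have : Real.exp (-s) < 1 := by rw [Real.exp_lt_one_iff]; linarith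
    exact_mod_cast (sub_pos.2 this).ne'
  have hval : ∑' n : ℕ, cotTerm z n =
      -(2 * Real.pi * Complex.I) * ((1 / (1 - Real.exp (-s)) - 1 / s - 1 / 2 : ℝ) : ℂ) := by
    have h := cot_series_rep' hmem
    simp only [cotTerm]
    rw [← h, Complex.cot_pi_eq_exp_ratio, hexp, hz]
    push_cast at he1 ⊢
    field_simp
    ring_nf
    simp only [Complex.I_sq]
    ring
  rw [hval] at hsum
  have hsum2 := hsum.mul_left (-(2 * Real.pi * Complex.I))⁻¹
  have h0 : (-(2 * Real.pi * Complex.I)) ≠ 0 := by simp [hpc]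
  rw [inv_mul_cancel_left₀ h0] at hsum2
  rw [← Complex.hasSum_ofReal]
  refine (congrArg (HasSum · _) (funext fun n => ?_)).mpr hsum2
  have hn1 : z - (n + 1) ≠ 0 := by
    simpa [sub_eq_add_neg] using Complex.integerComplement_add_ne_zero hmem (-(n + 1) : ℤ)
  have hn2 : z + (n + 1) ≠ 0 := by
    simpa using Complex.integerComplement_add_ne_zero hmem ((n : ℤ) + 1)
  have hd : (s : ℂ) ^ 2 + (2 * Real.pi * (n + 1)) ^ 2 ≠ 0 := by
    exact_mod_cast (by positivity : (s ^ 2 + (2 * Real.pi * ((n : ℝ) + 1)) ^ 2) ≠ 0)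
  have hprod : (z - (n + 1)) * (z + (n + 1)) =
      -((s : ℂ) ^ 2 + (2 * Real.pi * (n + 1)) ^ 2) / (2 * Real.pi) ^ 2 := by
    rw [hz]
    push_cast
    field_simp
    ring_nf
    simp only [Complex.I_sq]
    ring
  rw [cotTerm, div_add_div _ _ hn1 hn2, hprod, hz]
  push_cast
  field_simp
  ring

lemma hasSum_one_div_exp_sub_one {y : ℝ} (hy : 0 < y) :
    HasSum (fun n : ℕ => Real.exp (-((n + 1) * y))) (1 / (Real.exp y - 1)) := by
  have h1 : Real.exp (-y) < 1 := by rw [Real.exp_lt_one_iff]; linarith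
  have h := (hasSum_geometric_of_lt_one (Real.exp_pos _).le h1).mul_left (Real.exp (-y))
  have hv : Real.exp (-y) * (1 - Real.exp (-y))⁻¹ = 1 / (Real.exp y - 1) := by
    have h2 : Real.exp y - 1 ≠ 0 := by
      have := Real.add_one_lt_exp hy.ne'
      linarith
    have h3 : 1 - Real.exp (-y) ≠ 0 := by linarith
    have h4 : Real.exp (-y) * Real.exp y = 1 := by rw [← Real.exp_add]; simp
    field_simp
    linear_combination h4
  rw [hv] at h
  refine (congrArg (HasSum · _) (funext fun n => ?_)).mpr h
  rw [← Real.exp_nat_mul, ← Real.exp_add]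
  ring_nf

/-- Term-by-term integration of a series of nonnegative functions. -/
lemma integral_Ioi_eq_tsum_of_nonneg {f : ℕ → ℝ → ℝ} {F : ℝ → ℝ} (hF : Measurable F)
    (hf : ∀ n, IntegrableOn (f n) (Ioi 0)) (hf0 : ∀ n, ∀ x ∈ Ioi (0 : ℝ), 0 ≤ f n x)
    (hs : ∀ x ∈ Ioi (0 : ℝ), HasSum (fun n => f n x) (F x)) :
    ∫ x in Ioi 0, F x = (∑' n, ENNReal.ofReal (∫ x in Ioi 0, f n x)).toReal := by
  rw [integral_eq_lintegral_of_nonneg_ae _ hF.aestronglyMeasurable]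
  · congr 1
    have hterm : ∀ n, ENNReal.ofReal (∫ x in Ioi 0, f n x) =
        ∫⁻ x in Ioi 0, ENNReal.ofReal (f n x) := fun n =>
      ofReal_integral_eq_lintegral_ofReal (hf n)
        ((ae_restrict_iff' measurableSet_Ioi).2 (.of_forall (hf0 n)))
    simp_rw [hterm]
    rw [← lintegral_tsum fun n => (hf n).aestronglyMeasurable.aemeasurable.ennreal_ofReal]
    refine setLIntegral_congr_fun measurableSet_Ioi fun x hx => ?_
    rw [← (hs x hx).tsum_eq, ENNReal.ofReal_tsum_of_nonneg (fun n => hf0 n x hx) (hs x hx).summable]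
  · exact (ae_restrict_iff' measurableSet_Ioi).2
      (.of_forall fun x hx => (hs x hx).nonneg fun n => hf0 n x hx)

lemma integrableOn_div_sq_add_sq_mul_exp {a c : ℝ} (ha : 0 < a) (hc : 0 < c) :
    IntegrableOn (fun x : ℝ => 2 * x / (x ^ 2 + c ^ 2) * Real.exp (-a * x)) (Ioi 0) := by
  refine ((exp_neg_integrableOn_Ioi 0 ha).const_mul c⁻¹).mono'
    (Measurable.aestronglyMeasurable (by fun_prop)) ?_
  refine (ae_restrict_iff' measurableSet_Ioi).2 (.of_forall fun x hx => ?_)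
  have hx : 0 < x := hx
  rw [Real.norm_of_nonneg (by positivity)]
  gcongr
  rw [div_le_iff₀ (by positivity), inv_mul_eq_div, le_div_iff₀ hc]
  nlinarith [sq_nonneg (x - c)]

lemma integral_div_sq_add_sq_mul_exp_eq {a b c d : ℝ} (hb : 0 < b) (hc : 0 < c)
    (h : a * c = d * b) :
    ∫ x in Ioi (0 : ℝ), 2 * x / (x ^ 2 + c ^ 2) * Real.exp (-a * x) =
      ∫ x in Ioi (0 : ℝ), 2 * x / (x ^ 2 + b ^ 2) * Real.exp (-d * x) := by
  have hk : 0 < b / c := by positivity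
  have key := integral_comp_mul_left_Ioi
    (fun x : ℝ => 2 * x / (x ^ 2 + b ^ 2) * Real.exp (-d * x)) 0 hk
  rw [mul_zero, smul_eq_mul] at key
  rw [← mul_right_inj' (inv_pos.2 hk).ne', ← key, ← integral_const_mul]
  congr 1 with x
  have h1 : -d * (b / c * x) = -a * x := by
    field_simp
    linear_combination x * h
  have h2 : x ^ 2 + c ^ 2 ≠ 0 := by positivity
  have h3 : (b / c * x) ^ 2 + b ^ 2 ≠ 0 := by positivity
  have h4 : (b / c * x) ^ 2 + b ^ 2 = (b / c) ^ 2 * (x ^ 2 + c ^ 2) := by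
    field_simp
  rw [h1, h4]
  field_simp

lemma one_div_one_sub_exp_neg_le {s : ℝ} (hs : 0 < s) :
    1 / (1 - Real.exp (-s)) - 1 / s - 1 / 2 ≤ 1 / 2 := by
  have h1 : Real.exp (-s) < 1 := by rw [Real.exp_lt_one_iff]; linarith
  have h2 : (s + 1) * Real.exp (-s) ≤ 1 := by
    have h3 : Real.exp s * Real.exp (-s) = 1 := by rw [← Real.exp_add]; simp
    have := mul_le_mul_of_nonneg_right (Real.add_one_le_exp s) (Real.exp_pos (-s)).le
    linarith
  have h4 : 1 / (1 - Real.exp (-s)) ≤ 1 + 1 / s := by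
    rw [div_le_iff₀ (by linarith)]
    have : (1 + 1 / s) * (1 - Real.exp (-s)) = ((s + 1) - (s + 1) * Real.exp (-s)) / s := by
      field_simp
    rw [this, le_div_iff₀ hs]
    linarith
  linarith

/-- The two integral forms of the remainder in Binet's formula for `log Γ` agree. -/
lemma integral_binet_eq {t : ℝ} (ht : 0 < t) :
    ∫ s in Ioi (0 : ℝ), (1 / (1 - Real.exp (-s)) - 1 / s - 1 / 2) * Real.exp (-(t / 2) * s) =
      ∫ x in Ioi (0 : ℝ), 2 * x / (x ^ 2 + t ^ 2) * (1 / (Real.exp (Real.pi * x) - 1)) := by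
  have hpi := Real.pi_pos
  rw [integral_Ioi_eq_tsum_of_nonneg
      (f := fun n s => 2 * s / (s ^ 2 + (2 * Real.pi * (n + 1)) ^ 2) * Real.exp (-(t / 2) * s))
      (by fun_prop) (fun n => integrableOn_div_sq_add_sq_mul_exp (by positivity) (by positivity))
      (fun n x (hx : 0 < x) => by positivity)
      (fun x hx => (hasSum_one_div_one_sub_exp_neg hx).mul_right _),
    integral_Ioi_eq_tsum_of_nonneg
      (f := fun n x => 2 * x / (x ^ 2 + t ^ 2) * Real.exp (-((n + 1) * Real.pi) * x))
      (by fun_prop) (fun n => integrableOn_div_sq_add_sq_mul_exp (by positivity) ht)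
      (fun n x (hx : 0 < x) => by positivity) (fun x hx => ?_)]
  · congr! 4 with n
    exact integral_div_sq_add_sq_mul_exp_eq ht (by positivity) (by ring)
  · have hx : 0 < x := hx
    have h := (hasSum_one_div_exp_sub_one (y := Real.pi * x) (by positivity)).mul_left
      (2 * x / (x ^ 2 + t ^ 2))
    simpa only [← mul_assoc, neg_mul] using h

lemma integral_one_div_sub_one_div_one_sub_exp_neg {t : ℝ} (ht : 0 < t) :
    ∫ s in Ioi (0 : ℝ), (1 / s - 1 / (1 - Real.exp (-s))) * Real.exp (-t * s / 2) =
      -(∫ s in Ioi (0 : ℝ), (1 / (1 - Real.exp (-s)) - 1 / s - 1 / 2) * Real.exp (-(t / 2) * s))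
        - 1 / t := by
  have hE := exp_neg_integrableOn_Ioi 0 (half_pos ht)
  have hG : IntegrableOn (fun s : ℝ => (1 / (1 - Real.exp (-s)) - 1 / s - 1 / 2) *
      Real.exp (-(t / 2) * s)) (Ioi 0) := by
    refine (hE.const_mul (1 / 2)).mono' (Measurable.aestronglyMeasurable (by fun_prop)) ?_
    refine (ae_restrict_iff' measurableSet_Ioi).2 (.of_forall fun x hx => ?_)
    have hx : 0 < x := hx
    have h0 := (hasSum_one_div_one_sub_exp_neg hx).nonneg fun n => by positivity
    rw [Real.norm_of_nonneg (mul_nonneg h0 (Real.exp_pos _).le)]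
    gcongr
    exact one_div_one_sub_exp_neg_le hx
  have hint : ∫ s in Ioi (0 : ℝ), Real.exp (-(t / 2) * s) = 2 / t := by
    rw [integral_exp_mul_Ioi (by linarith)]
    simp
  calc _ = ∫ s in Ioi (0 : ℝ), (-((1 / (1 - Real.exp (-s)) - 1 / s - 1 / 2) *
        Real.exp (-(t / 2) * s)) - 1 / 2 * Real.exp (-(t / 2) * s)) := by
        congr 1 with s
        rw [show -t * s / 2 = -(t / 2) * s by ring]
        ring
    _ = _ := by
        rw [integral_sub (Integrable.fun_neg hG) (hE.const_mul _), integral_neg, integral_const_mul, hint]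
        ring

lemma integrable_sinh_kernel {t : ℝ} (ht : 0 < t) :
    Integrable fun x : ℝ => (1 + Complex.I * t * x) / (Complex.I * t - x) *
      ((|x| / ((1 + x ^ 2) * (Real.exp (Real.pi * |x|) - 1)) : ℝ) : ℂ) := by
  have hpi := Real.pi_pos
  refine (integrable_inv_one_add_sq.const_mul ((t + 1 / t) * Real.pi⁻¹)).mono'
    (Measurable.aestronglyMeasurable (by fun_prop)) (.of_forall fun x => ?_)
  rw [norm_mul, mul_assoc (t + 1 / t)]
  gcongr
  · rw [norm_div]
    have h1 : ‖1 + Complex.I * t * x‖ ^ 2 = 1 + (t * x) ^ 2 := by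
      rw [← Complex.normSq_eq_norm_sq, Complex.normSq_apply]
      simp
      ring
    have h2 : ‖Complex.I * t - x‖ ^ 2 = t ^ 2 + x ^ 2 := by
      rw [← Complex.normSq_eq_norm_sq, Complex.normSq_apply]
      simp
      ring
    refine div_le_of_le_mul₀ (norm_nonneg _) (by positivity) ?_
    refine le_of_sq_le_sq ?_ (by positivity)
    rw [mul_pow, h1, h2]
    have h3 : (t + 1 / t) ^ 2 * (t ^ 2 + x ^ 2) =
        1 + (t * x) ^ 2 + (t ^ 4 + 2 * t ^ 2 + 2 * x ^ 2 + (1 / t) ^ 2 * x ^ 2) := by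
      field_simp
      ring
    rw [h3]
    have : 0 ≤ t ^ 4 + 2 * t ^ 2 + 2 * x ^ 2 + (1 / t) ^ 2 * x ^ 2 := by positivity
    linarith
  · rcases eq_or_ne x 0 with rfl | hx
    · simp [hpi.le]
    have hx : 0 < |x| := abs_pos.2 hx
    have h1 := Real.add_one_le_exp (Real.pi * |x|)
    have h2 : 0 < Real.pi * |x| := by positivity
    have h3 : 0 < Real.exp (Real.pi * |x|) - 1 := by linarith
    rw [Complex.norm_real, Real.norm_of_nonneg (by positivity), ← mul_inv, ← one_div,
      div_le_div_iff₀ (by positivity) (by positivity)]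
    have : 0 < 1 + x ^ 2 := by positivity
    nlinarith

lemma integral_sinh_kernel {t : ℝ} (ht : 0 < t) :
    ∫ x : ℝ, (1 + Complex.I * t * x) / (Complex.I * t - x) *
        ((|x| / ((1 + x ^ 2) * (Real.exp (Real.pi * |x|) - 1)) : ℝ) : ℂ) =
      -(Complex.I * t) * ((∫ x in Ioi (0 : ℝ),
        2 * x / (x ^ 2 + t ^ 2) * (1 / (Real.exp (Real.pi * x) - 1)) : ℝ) : ℂ) := by
  set f : ℝ → ℂ := fun x => (1 + Complex.I * t * x) / (Complex.I * t - x) *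
    ((|x| / ((1 + x ^ 2) * (Real.exp (Real.pi * |x|) - 1)) : ℝ) : ℂ) with hf
  have hfi : Integrable f := integrable_sinh_kernel ht
  set h : ℝ → ℝ := fun x => 2 * x / (x ^ 2 + t ^ 2) * (1 / (Real.exp (Real.pi * x) - 1)) with hh
  have hsym : ∀ x, f x + f (-x) = -(Complex.I * t) * (h |x| : ℝ) := by
    intro x
    have h1 : Complex.I * t - x ≠ 0 := fun h0 => by
      have := congrArg Complex.im h0
      simp at this
      exact ht.ne' this
    have h2 : Complex.I * t + x ≠ 0 := fun h0 => by
      have := congrArg Complex.im h0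
      simp at this
      exact ht.ne' this
    have h3 : (1 + x ^ 2 : ℂ) ≠ 0 := by
      exact_mod_cast (by positivity : (1 + x ^ 2 : ℝ) ≠ 0)
    have h4 : (x ^ 2 + t ^ 2 : ℂ) ≠ 0 := by
      exact_mod_cast (by positivity : (x ^ 2 + t ^ 2 : ℝ) ≠ 0)
    have hk : (1 + Complex.I * t * x) / (Complex.I * t - x) +
        (1 - Complex.I * t * x) / (Complex.I * t + x) =
        -(Complex.I * t) * 2 * (1 + x ^ 2) / (x ^ 2 + t ^ 2) := by
      rw [div_add_div _ _ h1 h2, div_eq_div_iff (mul_ne_zero h1 h2) h4]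
      ring_nf
      simp only [Complex.I_pow_three]
      ring
    simp only [hf, hh, abs_neg, sq_abs, neg_sq]
    push_cast
    rw [mul_neg, sub_neg_eq_add, ← sub_eq_add_neg, ← add_mul, hk]
    simp only [div_eq_mul_inv, mul_inv]
    field_simp
  have h2 : (2 : ℂ) * ∫ x, f x = 2 * (-(Complex.I * t) * ((∫ x in Ioi (0 : ℝ), h x : ℝ) : ℂ)) := by
    calc (2 : ℂ) * ∫ x, f x = (∫ x, f x) + ∫ x, f (-x) := by
          rw [integral_neg_eq_self]; ring
      _ = ∫ x, -(Complex.I * t) * (h |x| : ℝ) := by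
          rw [← integral_add hfi hfi.comp_neg]
          simp_rw [hsym]
      _ = _ := by
          rw [integral_const_mul, integral_complex_ofReal, integral_comp_abs]
          push_cast
          ring
  exact mul_left_cancel₀ two_ne_zero h2

/-- For every `t > 0`,
`i(1 + t ∫_0^∞ (1/s - 1/(1-e^{-s})) e^{-ts/2} ds)
  = ∫_ℝ (1 + itx)/(it - x) · |x|/((1+x²)(e^{π|x|}-1)) dx`. -/
theorem voiculescu_sinh_representation (t : ℝ) (ht : 0 < t) :
    Complex.I * (1 + (t : ℂ) *
        ((∫ s in Set.Ioi (0 : ℝ), (1 / s - 1 / (1 - Real.exp (-s))) * Real.exp (-t * s / 2) : ℝ) : ℂ)) =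
      ∫ x : ℝ, (1 + Complex.I * t * x) / (Complex.I * t - x) *
        ((|x| / ((1 + x ^ 2) * (Real.exp (Real.pi * |x|) - 1)) : ℝ) : ℂ) := by
  rw [integral_sinh_kernel ht, integral_one_div_sub_one_div_one_sub_exp_neg ht,
    integral_binet_eq ht]
  have htc : (t : ℂ) ≠ 0 := by exact_mod_cast ht.ne'
  generalize ∫ x in Ioi (0 : ℝ),
    2 * x / (x ^ 2 + t ^ 2) * (1 / (Real.exp (Real.pi * x) - 1)) = B
  push_cast
  field_simp
  ring
end

section
/- 2·∫_0^∞ x / ((1 + x²)·(e^{πx} - 1)) dx = γ + log 2 - 1, where γ is the Euler–Mascheroni constant. -/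
open Real Set Filter Topology MeasureTheory

/-- Mittag-Leffler expansion of the hyperbolic cotangent. -/
lemma hasSum_coth_sub_inv {t : ℝ} (ht : 0 < t) :
    HasSum (fun n : ℕ ↦ 2 * (t / (t ^ 2 + ((n + 1) * π) ^ 2))) (cosh t / sinh t - 1 / t) := by
  have hπ := pi_pos
  set z : ℂ := (t / π : ℝ) * Complex.I with hz
  have hzi : z ∈ Complex.integerComplement := by
    rw [Complex.mem_integerComplement_iff]
    rintro ⟨n, hn⟩
    have := congrArg Complex.im hn
    simp only [hz, Complex.intCast_im, Complex.im_ofReal_mul,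
      Complex.I_im, mul_one] at this
    exact (div_pos ht hπ).ne this
  have h := (summable_cotTerm hzi).hasSum
  rw [← cot_series_rep' hzi] at h
  have hπz : (π : ℂ) * z = t * Complex.I := by
    rw [hz]; push_cast; field_simp
  have h2 := h.mul_left (Complex.I / π)
  rw [← Complex.hasSum_ofReal]
  convert h2 using 1
  · rfl
  · funext n
    have e1 : z - (n + 1) ≠ 0 := by
      simpa [sub_eq_add_neg] using Complex.integerComplement_add_ne_zero hzi (-(n + 1) : ℤ)
    have e2 : z + (n + 1) ≠ 0 := by
      simpa using Complex.integerComplement_add_ne_zero hzi ((n : ℤ) + 1)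
    have e3 : (t : ℂ) ^ 2 + ((n + 1) * π) ^ 2 = - π ^ 2 * ((z - (n + 1)) * (z + (n + 1))) := by
      have : (t : ℂ) ^ 2 = - (π * z) ^ 2 := by rw [hπz, mul_pow, Complex.I_sq]; ring
      rw [this]; ring
    push_cast
    rw [e3, cotTerm, div_add_div _ _ e1 e2]
    have : Complex.I * z = - (t / π) := by
      rw [hz]; push_cast; linear_combination (t / π : ℂ) * Complex.I_sq
    have ht' : (t : ℂ) = - π * (Complex.I * z) := by rw [this]; field_simp
    rw [ht']
    field_simp
    ring
  · rw [hπz, Complex.cot, Complex.cos_mul_I, Complex.sin_mul_I]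
    push_cast
    rw [hz]
    push_cast
    field_simp

lemma coth_sub_inv_nonneg {t : ℝ} (ht : 0 < t) : 0 ≤ cosh t / sinh t - 1 / t :=
  (hasSum_coth_sub_inv ht).nonneg fun n ↦ by positivity

lemma coth_sub_inv_le_one {t : ℝ} (ht : 0 < t) : cosh t / sinh t - 1 / t ≤ 1 := by
  have hs : 0 < sinh t := sinh_pos_iff.2 ht
  have h1 : t ≤ sinh t := self_le_sinh_iff.2 ht.le
  have h2 : cosh t - sinh t ≤ 1 := by
    rw [cosh_sub_sinh]; exact exp_le_one_iff.2 (by linarith)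
  rw [sub_le_iff_le_add, div_le_iff₀ hs]
  have : 1 ≤ 1 / t * sinh t := by rw [one_div_mul_eq_div, le_div_iff₀ ht]; linarith
  linarith

lemma integrableOn_exp_mul_coth_sub_inv {z : ℝ} (hz : 0 < z) :
    IntegrableOn (fun t ↦ exp (-z * t) * (cosh t / sinh t - 1 / t)) (Ioi 0) := by
  refine Integrable.mono' (exp_neg_integrableOn_Ioi 0 hz) (by fun_prop) ?_
  filter_upwards [ae_restrict_mem measurableSet_Ioi] with t ht
  rw [norm_mul, norm_of_nonneg (exp_pos _).le, norm_of_nonneg (coth_sub_inv_nonneg ht)]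
  exact mul_le_of_le_one_right (exp_pos _).le (coth_sub_inv_le_one ht)

lemma integral_exp_neg_mul_Ioi_zero {z : ℝ} (hz : 0 < z) :
    ∫ t in Ioi (0 : ℝ), exp (-z * t) = 1 / z := by
  rw [integral_exp_mul_Ioi (by linarith)]
  simp [neg_div_neg_eq]

/-- The Laplace transform of `coth t - 1 / t` satisfies a first-order difference equation. -/
lemma integral_exp_mul_coth_sub_inv_sub {z : ℝ} (hz : 0 < z) :
    (∫ t in Ioi (0 : ℝ), exp (-z * t) * (cosh t / sinh t - 1 / t)) -
      ∫ t in Ioi (0 : ℝ), exp (-(z + 2) * t) * (cosh t / sinh t - 1 / t) =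
      1 / z + 1 / (z + 2) - log ((z + 2) / z) := by
  have hz2 : 0 < z + 2 := by linarith
  have i1 := integrableOn_exp_mul_coth_sub_inv hz
  have i2 := integrableOn_exp_mul_coth_sub_inv hz2
  have j1 := exp_neg_integrableOn_Ioi 0 hz
  have j2 := exp_neg_integrableOn_Ioi 0 hz2
  have key : ∀ t ∈ Ioi (0 : ℝ), t⁻¹ • (exp (-(z * t)) - exp (-((z + 2) * t))) =
      (exp (-z * t) + exp (-(z + 2) * t)) -
        (exp (-z * t) * (cosh t / sinh t - 1 / t) -
          exp (-(z + 2) * t) * (cosh t / sinh t - 1 / t)) := by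
    intro t ht
    have ht : 0 < t := ht
    have hs : sinh t ≠ 0 := (sinh_pos_iff.2 ht).ne'
    have h2 : exp (-(z + 2) * t) = exp (-z * t) * exp (-t) ^ 2 := by
      rw [← exp_nat_mul, ← exp_add]; congr 1; push_cast; ring
    have h3 : (1 - exp (-t) ^ 2) * cosh t = (1 + exp (-t) ^ 2) * sinh t := by
      have : exp t * exp (-t) = 1 := by rw [← exp_add]; simp
      rw [cosh_eq, sinh_eq]
      linear_combination (- exp (-t)) * this
    have h4 : (1 - exp (-t) ^ 2) * (cosh t / sinh t) = 1 + exp (-t) ^ 2 := by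
      rw [← mul_div_assoc, h3, mul_div_cancel_right₀ _ hs]
    rw [← neg_mul, ← neg_mul, h2, smul_eq_mul]
    linear_combination exp (-z * t) * h4
  have j12 : IntegrableOn (fun t ↦ exp (-z * t) + exp (-(z + 2) * t)) (Ioi 0) := j1.add j2
  have i12 : IntegrableOn (fun t ↦ exp (-z * t) * (cosh t / sinh t - 1 / t) -
      exp (-(z + 2) * t) * (cosh t / sinh t - 1 / t)) (Ioi 0) := i1.sub i2
  have hfr := (j12.sub i12).congr_fun (fun t ht ↦ (key t ht).symm)
    measurableSet_Ioi
  have hc : Continuous fun x : ℝ ↦ exp (-x) := by fun_prop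
  have hF := Frullani.integral_Ioi_eq (f := fun x : ℝ ↦ exp (-x)) (L := 1) (R := 0)
    (hc.locallyIntegrable.locallyIntegrableOn _) hz hz2
    (by simpa using (hc.tendsto 0).mono_left nhdsWithin_le_nhds)
    (tendsto_exp_atBot.comp tendsto_neg_atTop_atBot) hfr
  rw [setIntegral_congr_fun measurableSet_Ioi key, integral_sub j12 i12,
    integral_add j1 j2, integral_sub i1 i2, integral_exp_neg_mul_Ioi_zero hz,
    integral_exp_neg_mul_Ioi_zero hz2] at hF
  simp only [sub_zero, smul_eq_mul, mul_one] at hF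
  linarith

lemma integral_exp_mul_coth_sub_inv_eq_harmonic (N : ℕ) :
    (∫ t in Ioi (0 : ℝ), exp (-1 * t) * (cosh t / sinh t - 1 / t)) =
      (∫ t in Ioi (0 : ℝ), exp (-(2 * N + 1) * t) * (cosh t / sinh t - 1 / t)) +
      (2 * harmonic (2 * N) - harmonic N - 1 + 1 / (2 * N + 1) - log (2 * N + 1)) := by
  induction N with
  | zero => simp
  | succ N ih =>
    have h := integral_exp_mul_coth_sub_inv_sub (z := 2 * N + 1) (by positivity)
    rw [log_div (by positivity) (by positivity)] at h
    have e : (2 * ((N + 1 : ℕ) : ℝ) + 1) = 2 * N + 1 + 2 := by push_cast; ring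
    rw [e, ih, show 2 * (N + 1) = 2 * N + 1 + 1 by ring, harmonic_succ, harmonic_succ,
      harmonic_succ]
    have h3 : 2 * ((2 * (N : ℝ) + 1 + 1)⁻¹) = ((N : ℝ) + 1)⁻¹ := by
      field_simp
      ring
    push_cast
    linear_combination h - h3

lemma tendsto_integral_exp_mul_coth_sub_inv :
    Tendsto (fun N : ℕ ↦ ∫ t in Ioi (0 : ℝ),
      exp (-(2 * N + 1) * t) * (cosh t / sinh t - 1 / t)) atTop (𝓝 0) := by
  have hlim : Tendsto (fun N : ℕ ↦ 1 / ((N : ℝ) + 1)) atTop (𝓝 0) :=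
    tendsto_one_div_add_atTop_nhds_zero_nat
  refine squeeze_zero (fun N ↦ ?_) (fun N ↦ ?_) hlim
  · exact setIntegral_nonneg measurableSet_Ioi fun t ht ↦
      mul_nonneg (exp_pos _).le (coth_sub_inv_nonneg ht)
  · have hN : (0 : ℝ) < 2 * N + 1 := by positivity
    calc _ ≤ ∫ t in Ioi (0 : ℝ), exp (-(2 * N + 1) * t) :=
          setIntegral_mono_on (integrableOn_exp_mul_coth_sub_inv hN)
            (exp_neg_integrableOn_Ioi 0 hN) measurableSet_Ioi fun t ht ↦
            mul_le_of_le_one_right (exp_pos _).le (coth_sub_inv_le_one ht)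
      _ = 1 / (2 * N + 1) := integral_exp_neg_mul_Ioi_zero hN
      _ ≤ 1 / (N + 1) := by
          have : (0 : ℝ) ≤ N := by positivity
          gcongr
          linarith

lemma integral_exp_neg_mul_coth_sub_inv :
    ∫ t in Ioi (0 : ℝ), exp (-1 * t) * (cosh t / sinh t - 1 / t) =
      eulerMascheroniConstant + log 2 - 1 := by
  have h2 : Tendsto (fun N : ℕ ↦ 2 * N) atTop atTop :=
    tendsto_id.const_mul_atTop' (by norm_num)
  have a1 := (tendsto_harmonic_sub_log.comp h2).const_mul 2
  have a2 := tendsto_harmonic_sub_log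
  have a3 : Tendsto (fun N : ℕ ↦ log ((2 * N : ℕ) + 1) - log (2 * N : ℕ)) atTop (𝓝 0) :=
    (tendsto_log_comp_add_sub_log 1).comp (tendsto_natCast_atTop_atTop.comp h2)
  have a4 : Tendsto (fun N : ℕ ↦ 1 / (((2 * N : ℕ) : ℝ) + 1)) atTop (𝓝 0) :=
    tendsto_one_div_add_atTop_nhds_zero_nat.comp h2
  have h := ((((a1.sub a2).sub a3).add a4).add tendsto_integral_exp_mul_coth_sub_inv).add_const
    (log 2 - 1)
  have h' := tendsto_nhds_unique (h.congr' (f₂ := fun _ ↦ ∫ t in Ioi (0 : ℝ),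
    exp (-1 * t) * (cosh t / sinh t - 1 / t)) ?_) tendsto_const_nhds
  · rw [← h']; ring
  · filter_upwards [eventually_ne_atTop 0] with N hN
    have hN' : (N : ℝ) ≠ 0 := by exact_mod_cast hN
    rw [integral_exp_mul_coth_sub_inv_eq_harmonic N]
    simp only [Function.comp_apply]
    push_cast
    rw [log_mul (by norm_num) hN']
    ring

lemma integral_div_one_add_sq_mul_exp {a : ℝ} (ha : 0 < a) :
    ∫ x in Ioi (0 : ℝ), x / (1 + x ^ 2) * exp (-a * x) =
      ∫ t in Ioi (0 : ℝ), exp (-1 * t) * (t / (t ^ 2 + a ^ 2)) := by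
  have h := integral_comp_mul_left_Ioi' (fun t ↦ exp (-1 * t) * (t / (t ^ 2 + a ^ 2))) 0 ha
  rw [mul_zero] at h
  rw [← h, smul_eq_mul, ← integral_const_mul]
  congr with x
  have : 1 + x ^ 2 ≠ 0 := by positivity
  have h2 : (a * x) ^ 2 + a ^ 2 ≠ 0 := by positivity
  rw [show -1 * (a * x) = -a * x by ring]
  field_simp
  ring

lemma integrableOn_div_one_add_sq_mul_exp {a : ℝ} (ha : 0 < a) :
    IntegrableOn (fun x ↦ x / (1 + x ^ 2) * exp (-a * x)) (Ioi 0) := by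
  refine Integrable.mono' (exp_neg_integrableOn_Ioi 0 ha) (by fun_prop) ?_
  filter_upwards [ae_restrict_mem measurableSet_Ioi] with x hx
  have hx : 0 < x := hx
  rw [norm_of_nonneg (by positivity)]
  refine mul_le_of_le_one_left (exp_pos _).le ?_
  rw [div_le_one (by positivity)]
  nlinarith [sq_nonneg (x - 1)]

lemma integrableOn_exp_neg_mul_self : IntegrableOn (fun t : ℝ ↦ exp (-1 * t) * t) (Ioi 0) := by
  have h := Real.GammaIntegral_convergent (s := 2) (by norm_num)
  norm_num at h
  simpa using h

lemma exp_mul_div_sq_add_sq_le {t a : ℝ} (ht : 0 < t) (ha : 0 < a) :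
    exp (-1 * t) * (t / (t ^ 2 + a ^ 2)) ≤ 1 / a ^ 2 * (exp (-1 * t) * t) := by
  have : t / (t ^ 2 + a ^ 2) ≤ t / a ^ 2 := by
    gcongr
    nlinarith
  calc _ ≤ exp (-1 * t) * (t / a ^ 2) := by gcongr
    _ = _ := by ring

lemma integrableOn_exp_mul_div_sq_add_sq {a : ℝ} (ha : 0 < a) :
    IntegrableOn (fun t ↦ exp (-1 * t) * (t / (t ^ 2 + a ^ 2))) (Ioi 0) := by
  refine Integrable.mono' (integrableOn_exp_neg_mul_self.const_mul (1 / a ^ 2)) (by fun_prop) ?_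
  filter_upwards [ae_restrict_mem measurableSet_Ioi] with t ht
  have ht : 0 < t := ht
  rw [norm_of_nonneg (by positivity)]
  exact exp_mul_div_sq_add_sq_le ht ha

lemma summable_integral_exp_mul_div_sq_add_sq :
    Summable fun n : ℕ ↦
      ∫ t in Ioi (0 : ℝ), exp (-1 * t) * (t / (t ^ 2 + ((n + 1) * π) ^ 2)) := by
  have hs : Summable fun n : ℕ ↦ 1 / ((n : ℝ) + 1) ^ 2 := by
    have := (summable_nat_add_iff 1).2 (Real.summable_one_div_nat_pow.2 one_lt_two)
    simpa using this
  refine Summable.of_nonneg_of_le (fun n ↦ ?_) (fun n ↦ ?_)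
    ((hs.mul_left (1 / π ^ 2)).mul_right (∫ t in Ioi (0 : ℝ), exp (-1 * t) * t))
  · exact setIntegral_nonneg measurableSet_Ioi fun t (ht : 0 < t) ↦ by positivity
  · have hn : 0 < ((n : ℝ) + 1) * π := by positivity
    calc _ ≤ ∫ t in Ioi (0 : ℝ), 1 / (((n : ℝ) + 1) * π) ^ 2 * (exp (-1 * t) * t) :=
          setIntegral_mono_on (integrableOn_exp_mul_div_sq_add_sq hn)
            (integrableOn_exp_neg_mul_self.const_mul _) measurableSet_Ioi
            fun t ht ↦ exp_mul_div_sq_add_sq_le ht hn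
      _ = _ := by
          rw [integral_const_mul]
          congr 1
          field_simp

/-- `2∫_0^∞ x/((1+x²)(e^{πx}-1)) dx = γ + log 2 - 1`, where `γ` is the
Euler–Mascheroni constant. -/
theorem integral_sinh_khintchine_total_mass :
    2 * ∫ x in Set.Ioi (0 : ℝ), x / ((1 + x ^ 2) * (Real.exp (Real.pi * x) - 1)) =
      Real.eulerMascheroniConstant + Real.log 2 - 1 := by
  have hpos : ∀ n : ℕ, 0 < ((n : ℝ) + 1) * π := fun n ↦ by positivity
  have hA := hasSum_integral_of_summable_integral_norm (μ := volume.restrict (Ioi (0 : ℝ)))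
    (F := fun (n : ℕ) (x : ℝ) ↦ x / (1 + x ^ 2) * exp (-((n + 1) * π) * x))
    (fun n ↦ integrableOn_div_one_add_sq_mul_exp (hpos n)) (by
      refine summable_integral_exp_mul_div_sq_add_sq.congr fun n ↦ ?_
      rw [← integral_div_one_add_sq_mul_exp (hpos n)]
      refine setIntegral_congr_fun measurableSet_Ioi fun x (hx : 0 < x) ↦ ?_
      exact (norm_of_nonneg (by positivity)).symm)
  have hB := hasSum_integral_of_summable_integral_norm (μ := volume.restrict (Ioi (0 : ℝ)))
    (F := fun (n : ℕ) (t : ℝ) ↦ exp (-1 * t) * (t / (t ^ 2 + ((n + 1) * π) ^ 2)))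
    (fun n ↦ integrableOn_exp_mul_div_sq_add_sq (hpos n)) (by
      refine summable_integral_exp_mul_div_sq_add_sq.congr fun n ↦ ?_
      refine setIntegral_congr_fun measurableSet_Ioi fun x (hx : 0 < x) ↦ ?_
      exact (norm_of_nonneg (by positivity)).symm)
  simp only [fun n : ℕ ↦ integral_div_one_add_sq_mul_exp (hpos n)] at hA
  have hAB := hA.unique hB
  have eA : ∀ x ∈ Ioi (0 : ℝ), ∑' n : ℕ, x / (1 + x ^ 2) * exp (-((n + 1) * π) * x) =
      x / ((1 + x ^ 2) * (exp (π * x) - 1)) := by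
    intro x (hx : 0 < x)
    have hlt : exp (-(π * x)) < 1 := exp_lt_one_iff.2 (by linarith [mul_pos pi_pos hx])
    have h1 := ((hasSum_geometric_of_lt_one (exp_pos _).le hlt).mul_left
      (x / (1 + x ^ 2) * exp (-(π * x)))).tsum_eq
    have hgt : 1 < exp (π * x) := one_lt_exp_iff.2 (mul_pos pi_pos hx)
    have h2 : exp (π * x) - 1 ≠ 0 := by linarith
    have h3 : (1 : ℝ) + x ^ 2 ≠ 0 := by positivity
    convert h1 using 1
    · congr with n
      rw [mul_assoc, ← exp_nat_mul, ← exp_add]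
      ring_nf
    · rw [exp_neg]
      have h4 : 1 - (exp (π * x))⁻¹ ≠ 0 := by
        rw [← exp_neg]; linarith
      field_simp
  have eB : ∀ t ∈ Ioi (0 : ℝ),
      2 * ∑' n : ℕ, exp (-1 * t) * (t / (t ^ 2 + ((n + 1) * π) ^ 2)) =
      exp (-1 * t) * (cosh t / sinh t - 1 / t) := by
    intro t ht
    rw [← ((hasSum_coth_sub_inv ht).mul_left (exp (-1 * t))).tsum_eq, ← tsum_mul_left]
    congr with n
    ring
  rw [setIntegral_congr_fun measurableSet_Ioi eA] at hAB
  rw [hAB, ← integral_const_mul, setIntegral_congr_fun measurableSet_Ioi eB,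
    integral_exp_neg_mul_coth_sub_inv]
end

section
/- For every real x > 0, ∫_0^x cosh(x - s)·( 1/s - 2/(1 - e^{-2s}) ) ds = (e^{-x}/2)·Ei(x) + (e^{x}/2)·Ei(-x) - 1 + e^{-x} + cosh(x)·( log( (1 + e^{-x})/(1 - e^{-x}) ) - γ - log 2 ). -/
/-- The exponential integral `Ei`: for `x < 0`, `Ei(x) = -∫_{-x}^∞ e^{-t}/t dt`, and for
`x > 0`, `Ei(x) = γ + log x + Σ_{k=1}^∞ x^k/(k·k!)` (Cauchy principal value). -/
noncomputable def Ei (x : ℝ) : ℝ :=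
  if x < 0 then -∫ t in Set.Ioi (-x), Real.exp (-t) / t
  else Real.eulerMascheroniConstant + Real.log x +
    ∑' k : ℕ, x ^ (k + 1) / (((k + 1) * (k + 1).factorial : ℕ) : ℝ)

open Real Set Filter Topology MeasureTheory

/-- The entire part `∑_{k ≥ 1} x^k / (k · k!)` of the exponential integral is differentiable, with
derivative `∑ x^k / (k + 1)!`. -/
theorem hasDerivAt_tsum_pow_div_mul_factorial (x : ℝ) :
    HasDerivAt (fun y : ℝ => ∑' k : ℕ, y ^ (k + 1) / (((k + 1) * (k + 1).factorial : ℕ) : ℝ))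
      (∑' k : ℕ, x ^ k / ((k + 1).factorial : ℝ)) x := by
  set R : ℝ := |x| + 1
  have hx : x ∈ Metric.ball (0 : ℝ) R := by simp [R]
  refine hasDerivAt_tsum_of_isPreconnected
    (g := fun (k : ℕ) (y : ℝ) => y ^ (k + 1) / (((k + 1) * (k + 1).factorial : ℕ) : ℝ))
    (g' := fun (k : ℕ) (y : ℝ) => y ^ k / ((k + 1).factorial : ℝ))
    (u := fun k : ℕ => R ^ k / (k.factorial : ℝ))
    (t := Metric.ball (0 : ℝ) R) (y₀ := 0) (Real.summable_pow_div_factorial R) Metric.isOpen_ball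
    (convex_ball (0 : ℝ) R).isPreconnected ?_ ?_ ?_ ?_ hx
  · intro k y _
    convert! (hasDerivAt_pow (k + 1) y).div_const (((k + 1) * (k + 1).factorial : ℕ) : ℝ) using 1
    push_cast
    have : (k : ℝ) + 1 ≠ 0 := by positivity
    have : ((k + 1).factorial : ℝ) ≠ 0 := by positivity
    field_simp
  · intro k y hy
    have hy' : |y| ≤ R := by
      have := hy
      simp only [Metric.mem_ball, dist_zero_right, Real.norm_eq_abs] at this
      exact this.le
    rw [norm_div, norm_pow, Real.norm_eq_abs, Real.norm_natCast]
    gcongr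
    omega
  · exact Metric.mem_ball_self (by positivity)
  · simp

theorem tsum_pow_div_factorial_succ {x : ℝ} (hx : x ≠ 0) :
    ∑' k : ℕ, x ^ k / ((k + 1).factorial : ℝ) = (exp x - 1) / x := by
  have h : HasSum (fun n : ℕ => x ^ n / (n.factorial : ℝ)) (exp x) := by
    rw [Real.exp_eq_exp_ℝ]
    exact NormedSpace.expSeries_div_hasSum_exp x
  have h1 := ((hasSum_nat_add_iff' 1).2 h).div_const x
  simp only [Finset.range_one, Finset.sum_singleton, pow_zero, Nat.factorial_zero, Nat.cast_one,
    div_one] at h1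
  rw [← h1.tsum_eq]
  refine tsum_congr fun k => ?_
  rw [pow_succ]
  field_simp

theorem hasDerivAt_Ei_of_pos {x : ℝ} (hx : 0 < x) : HasDerivAt Ei (exp x / x) x := by
  have h := ((Real.hasDerivAt_log hx.ne').const_add eulerMascheroniConstant).add
    (hasDerivAt_tsum_pow_div_mul_factorial x)
  rw [tsum_pow_div_factorial_succ hx.ne'] at h
  convert! h.congr_of_eventuallyEq (f₁ := Ei) ?_ using 1
  · field_simp
    ring
  · filter_upwards [lt_mem_nhds hx] with y hy
    simp [Ei, hy.not_gt]

theorem tendsto_Ei_sub_log :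
    Tendsto (fun s => Ei s - log s) (𝓝[>] 0) (𝓝 eulerMascheroniConstant) := by
  have h := ((hasDerivAt_tsum_pow_div_mul_factorial 0).continuousAt.tendsto.const_add
    eulerMascheroniConstant).mono_left (nhdsWithin_le_nhds (s := Ioi 0))
  simp only [ne_eq, Nat.add_eq_zero_iff, one_ne_zero, and_false, not_false_eq_true, zero_pow,
    zero_div, tsum_zero, add_zero] at h
  refine h.congr' ?_
  filter_upwards [self_mem_nhdsWithin] with y hy
  simp only [Ei, if_neg (not_lt.2 (le_of_lt (mem_Ioi.1 hy)))]
  ring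

theorem integrableOn_exp_neg_div_Ioi {a : ℝ} (ha : 0 < a) :
    IntegrableOn (fun t => exp (-t) / t) (Ioi a) := by
  refine ((integrableOn_exp_neg_Ioi a).div_const a).mono' ?_ ?_
  · refine ContinuousOn.aestronglyMeasurable ?_ measurableSet_Ioi
    exact (continuous_neg.rexp.continuousOn).div continuousOn_id
      fun t ht => (ha.trans (mem_Ioi.1 ht)).ne'
  · filter_upwards [ae_restrict_mem measurableSet_Ioi] with t ht
    have ht : a < t := ht
    have := ha.trans ht
    rw [Real.norm_of_nonneg (by positivity)]
    gcongr

theorem hasDerivAt_Ei_neg {x : ℝ} (hx : 0 < x) :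
    HasDerivAt (fun s => Ei (-s)) (exp (-x) / x) x := by
  have hc : ∀ y : ℝ, 0 < y → ContinuousAt (fun t : ℝ => exp (-t) / t) y := fun y hy =>
    (continuous_neg.rexp.continuousAt).div continuousAt_id hy.ne'
  have hi : ∀ y : ℝ, 0 < y → IntervalIntegrable (fun t : ℝ => exp (-t) / t) volume 1 y := by
    intro y hy
    refine ContinuousOn.intervalIntegrable fun t ht => (hc t ?_).continuousWithinAt
    exact (lt_min one_pos hy).trans_le ht.1
  have h := (intervalIntegral.integral_hasDerivAt_right (hi x hx)
    ((ContinuousOn.stronglyMeasurableAtFilter isOpen_Ioi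
      (fun t ht => (hc t ht).continuousWithinAt)) x hx) (hc x hx)).sub_const
      (∫ t in Ioi (1 : ℝ), exp (-t) / t)
  refine h.congr_of_eventuallyEq ?_
  filter_upwards [lt_mem_nhds hx] with y hy
  have := intervalIntegral.integral_interval_add_Ioi (integrableOn_exp_neg_div_Ioi one_pos)
    (integrableOn_exp_neg_div_Ioi hy)
  simp only [Ei, Left.neg_neg_iff, hy, if_true, neg_neg]
  linarith

theorem mellin_log_exp_neg :
    MellinConvergent (fun t => log t • ((exp (-t) : ℝ) : ℂ)) 1 ∧
      HasDerivAt (mellin fun t => ((exp (-t) : ℝ) : ℂ))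
        (mellin (fun t => log t • ((exp (-t) : ℝ) : ℂ)) 1) 1 := by
  refine mellin_hasDerivAt_of_isBigO_rpow (E := ℂ) (a := 2) (b := 0) ?_ ?_ (by norm_num) ?_
    (by norm_num)
  · refine (Continuous.continuousOn ?_).locallyIntegrableOn measurableSet_Ioi
    exact Complex.continuous_ofReal.comp (Real.continuous_exp.comp continuous_neg)
  · rw [← Asymptotics.isBigO_norm_left]
    simp_rw [Complex.norm_real, Asymptotics.isBigO_norm_left]
    simpa only [neg_one_mul] using (isLittleO_exp_neg_mul_rpow_atTop zero_lt_one _).isBigO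
  · simp_rw [neg_zero, rpow_zero]
    refine Asymptotics.isBigO_const_of_tendsto (?_ : Tendsto _ _ (𝓝 (1 : ℂ))) one_ne_zero
    rw [(by simp : (1 : ℂ) = Real.exp (-0))]
    exact (Complex.continuous_ofReal.comp
      (Real.continuous_exp.comp continuous_neg)).continuousWithinAt

theorem integrableOn_log_mul_exp_neg : IntegrableOn (fun t => log t * exp (-t)) (Ioi 0) := by
  have h := mellin_log_exp_neg.1
  simp only [MellinConvergent, sub_self, Complex.cpow_zero, one_smul] at h
  simpa [IntegrableOn, -Complex.ofReal_exp] using h.re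

theorem integral_log_mul_exp_neg :
    ∫ t in Ioi 0, log t * exp (-t) = -eulerMascheroniConstant := by
  have h := mellin_log_exp_neg.2
  rw [← Complex.GammaIntegral_eq_mellin] at h
  have h2 : HasDerivAt Complex.GammaIntegral (-eulerMascheroniConstant : ℂ) 1 := by
    refine Complex.hasDerivAt_Gamma_one.congr_of_eventuallyEq ?_
    filter_upwards [(isOpen_lt continuous_const Complex.continuous_re).mem_nhds
      (show (0 : ℝ) < (1 : ℂ).re by norm_num)] with s hs
    exact (Complex.Gamma_eq_integral hs).symm
  have h3 := h.unique h2
  simp only [mellin, sub_self, Complex.cpow_zero, one_smul, Complex.real_smul,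
    ← Complex.ofReal_mul, integral_complex_ofReal, ← Complex.ofReal_neg] at h3
  exact_mod_cast h3

theorem Ei_neg_eq {x : ℝ} (hx : 0 < x) :
    Ei (-x) = exp (-x) * log x - ∫ t in Ioi x, log t * exp (-t) := by
  have hl := integrableOn_log_mul_exp_neg.mono_set (Ioi_subset_Ioi hx.le)
  have he := integrableOn_exp_neg_div_Ioi hx
  have h := integral_Ioi_of_hasDerivAt_of_tendsto' (a := x) (m := 0)
    (f := fun t => exp (-t) * log t) (f' := fun t => exp (-t) / t - log t * exp (-t))
    (fun t ht => ?_) (he.sub hl) ?_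
  · rw [integral_sub he hl] at h
    simp only [Ei, Left.neg_neg_iff, hx, if_true, neg_neg]
    linarith
  · have ht : 0 < t := hx.trans_le ht
    convert! ((hasDerivAt_neg t).exp).mul (Real.hasDerivAt_log ht.ne') using 1
    field_simp
    ring
  · refine squeeze_zero' (g := fun t => t ^ 1 * exp (-t)) ?_ ?_
      (Real.tendsto_pow_mul_exp_neg_atTop_nhds_zero 1)
    · filter_upwards [eventually_ge_atTop 1] with t ht
      have := Real.log_nonneg ht
      positivity
    · filter_upwards [eventually_ge_atTop 1] with t ht
      have := Real.log_le_self (zero_le_one.trans ht)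
      rw [mul_comm, pow_one]
      gcongr

theorem tendsto_Ei_neg_sub_log :
    Tendsto (fun s => Ei (-s) - log s) (𝓝[>] 0) (𝓝 eulerMascheroniConstant) := by
  have h1 := (integrableOn_log_mul_exp_neg.continuousWithinAt_Ici_primitive_Ioi.mono
    Ioi_subset_Ici_self).tendsto
  rw [integral_log_mul_exp_neg] at h1
  have h2 : Tendsto (fun s : ℝ => (exp (-s) - 1) / s) (𝓝[>] 0) (𝓝 (-1)) := by
    have := ((hasDerivAt_neg (0 : ℝ)).exp).tendsto_slope.mono_left
      (nhdsWithin_mono 0 (fun y hy => (ne_of_gt hy : y ≠ 0)) : 𝓝[>] (0 : ℝ) ≤ _)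
    simpa [slope_fun_def_field] using this
  have h3 := (tendsto_log_mul_rpow_nhdsGT_zero one_pos).mul h2
  have h4 := h3.sub h1
  simp only [zero_mul, sub_neg_eq_add, zero_add] at h4
  refine h4.congr' ?_
  filter_upwards [self_mem_nhdsWithin] with s hs
  have hs : 0 < s := hs
  rw [Ei_neg_eq hs, rpow_one]
  field_simp
  ring

/-- A primitive of `-1 / sinh`. -/
theorem hasDerivAt_log_coth_half {x : ℝ} (hx : 0 < x) :
    HasDerivAt (fun s => log ((1 + exp (-s)) / (1 - exp (-s))))
      (-(2 * exp (-x) / (1 - exp (-2 * x)))) x := by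
  have h1 : exp (-x) < 1 := by simpa using hx
  have h2 : 0 < 1 - exp (-x) := by linarith
  have h3 : 0 < 1 + exp (-x) := by positivity
  have hd := (hasDerivAt_neg x).exp
  convert! (((hd.const_add 1).div (hd.const_sub 1) h2.ne').log (div_pos h3 h2).ne') using 1
  have : exp (-2 * x) = exp (-x) * exp (-x) := by rw [← exp_add]; ring_nf
  have h4 : 1 - exp (-x) * exp (-x) = (1 - exp (-x)) * (1 + exp (-x)) := by ring
  simp only [Pi.div_apply]
  rw [this, h4]
  field_simp
  ring

theorem tendsto_log_coth_half_add_log :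
    Tendsto (fun s => log ((1 + exp (-s)) / (1 - exp (-s))) + log s) (𝓝[>] 0) (𝓝 (log 2)) := by
  have h2 : Tendsto (fun s : ℝ => (1 - exp (-s)) / s) (𝓝[>] 0) (𝓝 1) := by
    have := (((hasDerivAt_neg (0 : ℝ)).exp).const_sub 1).tendsto_slope.mono_left
      (nhdsWithin_mono 0 (fun y hy => (ne_of_gt hy : y ≠ 0)) : 𝓝[>] (0 : ℝ) ≤ _)
    simpa [slope_fun_def_field] using this
  have h1 : Tendsto (fun s : ℝ => 1 + exp (-s)) (𝓝[>] 0) (𝓝 2) := by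
    have : Continuous fun s : ℝ => 1 + exp (-s) := by fun_prop
    convert! (this.tendsto 0).mono_left nhdsWithin_le_nhds using 2
    norm_num
  have h := (h1.div h2 one_ne_zero).log (by norm_num)
  rw [div_one] at h
  refine h.congr' ?_
  filter_upwards [self_mem_nhdsWithin] with s hs
  have hs : 0 < s := hs
  have h5 : exp (-s) < 1 := by simpa using hs
  have h6 : 0 < 1 - exp (-s) := by linarith
  have h3 : 0 < 1 + exp (-s) := by positivity
  rw [← Real.log_mul (by positivity) hs.ne']
  congr 1
  simp only [Pi.div_apply]
  field_simp

theorem abs_one_div_sub_two_div_le {s : ℝ} (hs : 0 < s) :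
    |1 / s - 2 / (1 - exp (-2 * s))| ≤ 2 := by
  have h1 : exp (-2 * s) < 1 := by simpa using hs
  have h2 : 0 < 1 - exp (-2 * s) := by linarith
  have h3 : 1 - exp (-2 * s) ≤ 2 * s := by linarith [add_one_le_exp (-2 * s)]
  have h4 : 2 * s ≤ (1 + 2 * s) * (1 - exp (-2 * s)) := by
    have h5 : (1 + 2 * s) * exp (-2 * s) ≤ exp (2 * s) * exp (-2 * s) := by
      gcongr
      linarith [add_one_le_exp (2 * s)]
    rw [← exp_add, show 2 * s + -2 * s = 0 by ring, exp_zero] at h5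
    linarith
  have h5 : 1 / s ≤ 2 / (1 - exp (-2 * s)) := by
    rw [div_le_div_iff₀ hs h2]
    linarith
  have h6 : 2 / (1 - exp (-2 * s)) ≤ 1 / s + 2 := by
    rw [div_add' _ _ _ hs.ne', div_le_div_iff₀ h2 hs]
    linarith
  rw [abs_le]
  constructor <;> linarith

theorem intervalIntegrable_cosh_mul_kernel {x : ℝ} (hx : 0 < x) :
    IntervalIntegrable (fun s => cosh (x - s) * (1 / s - 2 / (1 - exp (-2 * s)))) volume 0 x := by
  refine IntervalIntegrable.continuousOn_mul ?_ (by fun_prop)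
  rw [intervalIntegrable_iff_integrableOn_Ioc_of_le hx.le]
  refine Measure.integrableOn_of_bounded (M := 2) (by simp) (by fun_prop) ?_
  filter_upwards [ae_restrict_mem measurableSet_Ioc] with s hs
  exact abs_one_div_sub_two_div_le hs.1

/-- For every `x > 0`,
`∫_0^x cosh(x-s)(1/s - 2/(1-e^{-2s})) ds = (e^{-x}/2) Ei(x) + (e^{x}/2) Ei(-x) - 1 + e^{-x}
  + cosh(x)(log((1+e^{-x})/(1-e^{-x})) - γ - log 2)`. -/
theorem convolution_cosh_digamma_kernel (x : ℝ) (hx : 0 < x) :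
    ∫ s in (0 : ℝ)..x, Real.cosh (x - s) * (1 / s - 2 / (1 - Real.exp (-2 * s))) =
      Real.exp (-x) / 2 * Ei x + Real.exp x / 2 * Ei (-x) - 1 + Real.exp (-x)
        + Real.cosh x * (Real.log ((1 + Real.exp (-x)) / (1 - Real.exp (-x)))
            - Real.eulerMascheroniConstant - Real.log 2) := by
  set L : ℝ → ℝ := fun s => log ((1 + exp (-s)) / (1 - exp (-s))) with hL
  have hG : ∀ s : ℝ, 0 < s → HasDerivAt
      (fun s => exp x / 2 * (Ei (-s) + L s) + exp (-x) / 2 * (Ei s + L s - 2 * exp s))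
      (cosh (x - s) * (1 / s - 2 / (1 - exp (-2 * s)))) s := by
    intro s hs
    have h1 : exp (-2 * s) < 1 := by simpa using hs
    have h2 : 1 - exp (-2 * s) ≠ 0 := by linarith
    convert! (((hasDerivAt_Ei_neg hs).add (hasDerivAt_log_coth_half hs)).const_mul (exp x / 2)).add
      ((((hasDerivAt_Ei_of_pos hs).add (hasDerivAt_log_coth_half hs)).sub
        ((Real.hasDerivAt_exp s).const_mul 2)).const_mul (exp (-x) / 2)) using 1
    have h3 : exp (-s) = exp s * exp (-2 * s) := by rw [← exp_add]; ring_nf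
    rw [cosh_eq, neg_sub, sub_eq_add_neg x s, sub_eq_add_neg s x, exp_add, exp_add, h3]
    generalize exp (-2 * s) = q at h2
    field_simp
    ring
  have h0 : Tendsto
      (fun s => exp x / 2 * (Ei (-s) + L s) + exp (-x) / 2 * (Ei s + L s - 2 * exp s)) (𝓝[>] 0)
      (𝓝 (exp x / 2 * (eulerMascheroniConstant + log 2)
        + exp (-x) / 2 * (eulerMascheroniConstant + log 2 - 2 * exp 0))) := by
    have he : Tendsto (fun s : ℝ => 2 * exp s) (𝓝[>] 0) (𝓝 (2 * exp 0)) :=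
      ((Real.continuous_exp.tendsto 0).const_mul 2).mono_left nhdsWithin_le_nhds
    refine (((tendsto_Ei_neg_sub_log.add tendsto_log_coth_half_add_log).const_mul _).add
      (((tendsto_Ei_sub_log.add tendsto_log_coth_half_add_log).sub he).const_mul _)).congr
      fun s => ?_
    simp only [hL]
    ring
  rw [intervalIntegral.integral_eq_sub_of_hasDerivAt_of_tendsto hx (fun s hs => hG s hs.1)
    (intervalIntegrable_cosh_mul_kernel hx) h0
    ((hG x hx).continuousAt.tendsto.mono_left nhdsWithin_le_nhds)]
  have h1 : exp (-x) * exp x = 1 := by rw [← exp_add]; simp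
  rw [cosh_eq, exp_zero]
  linear_combination -h1
end
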